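/- Fix an integer d ≥ 3, a finite set M and an integer r ≥ 1. For every p ∈ I_{d,r}(M) there exists a unique r-Markov invariant process μ(p) ∈ I_d(M) whose marginal on the ball S_r is equal to p. -/

import Mathlib

open MeasureTheory Filter Topology
open scoped ENNReal Classical

noncomputable section

namespace TreeEntropy

@[ext]
structure RCG (M : Type*) where
  col : List ℕ → Option M
  adj : List ℕ × List ℕ → Bool

variable {M : Type*}

def resS (r : ℕ) (g : RCG M) : RCG M where
  col l := if l.length ≤ r then g.col l else none
  adj p := if p.1.length ≤ r ∧ p.2.length ≤ r then g.adj p else false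

def rcgDist (g g' : RCG M) : ℝ :=
  ∑' r : ℕ, if resS r g = resS r g' then 0 else (2:ℝ)⁻¹ ^ r

private lemma rcg_summable (a b : RCG M) : Summable
    (fun r : ℕ => if resS r a = resS r b then (0:ℝ) else (2:ℝ)⁻¹ ^ r) := by
  refine Summable.of_nonneg_of_le (fun r => ?_) (fun r => ?_)
    (summable_geometric_of_lt_one (by norm_num) (by norm_num : (2:ℝ)⁻¹ < 1))
  · split
    · exact le_rfl
    · positivity
  · split
    · positivity
    · exact le_rfl

private lemma rcg_nonneg (a b : RCG M) (r : ℕ) :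
    (0:ℝ) ≤ if resS r a = resS r b then (0:ℝ) else (2:ℝ)⁻¹ ^ r := by
  split
  · exact le_rfl
  · positivity

private lemma rcgDist_self (g : RCG M) : rcgDist g g = 0 := by simp [rcgDist]

private lemma rcgDist_comm (g g' : RCG M) : rcgDist g g' = rcgDist g' g :=
  tsum_congr fun r => if_congr eq_comm rfl rfl

private lemma rcgDist_triangle (g₁ g₂ g₃ : RCG M) :
    rcgDist g₁ g₃ ≤ rcgDist g₁ g₂ + rcgDist g₂ g₃ := by
  unfold rcgDist
  rw [← Summable.tsum_add (rcg_summable _ _) (rcg_summable _ _)]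
  refine Summable.tsum_le_tsum (fun r => ?_) (rcg_summable _ _)
    ((rcg_summable _ _).add (rcg_summable _ _))
  have hx : (0:ℝ) ≤ (2:ℝ)⁻¹ ^ r := by positivity
  by_cases h12 : resS r g₁ = resS r g₂
  · by_cases h23 : resS r g₂ = resS r g₃
    · rw [if_pos h12, if_pos h23, if_pos (h12.trans h23)]; linarith
    · rw [if_pos h12, if_neg h23, zero_add]
      split_ifs <;> linarith
  · by_cases h23 : resS r g₂ = resS r g₃
    · rw [if_neg h12, if_pos h23, add_zero]
      split_ifs <;> linarith
    · rw [if_neg h12, if_neg h23]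
      split_ifs <;> linarith

private lemma rcgDist_eq_zero (g g' : RCG M) (h : rcgDist g g' = 0) : g = g' := by
  unfold rcgDist at h
  have hr : ∀ r : ℕ, resS r g = resS r g' := by
    intro r
    by_contra hne
    have hpos : (0:ℝ) <
        ∑' r : ℕ, if resS r g = resS r g' then (0:ℝ) else (2:ℝ)⁻¹ ^ r :=
      Summable.tsum_pos (rcg_summable g g') (rcg_nonneg g g') r
        (by rw [if_neg hne]; positivity)
    exact absurd h hpos.ne'
  have hc : g.col = g'.col := by
    funext l
    have h1 := congrFun (congrArg RCG.col (hr l.length)) l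
    simpa [resS] using h1
  have ha : g.adj = g'.adj := by
    funext p
    have h1 := congrFun (congrArg RCG.adj (hr (max p.1.length p.2.length))) p
    simpa [resS, le_max_left, le_max_right] using h1
  exact RCG.ext hc ha

instance : MetricSpace (RCG M) where
  dist := rcgDist
  dist_self := rcgDist_self
  dist_comm := rcgDist_comm
  dist_triangle := rcgDist_triangle
  eq_of_dist_eq_zero := rcgDist_eq_zero _ _

instance : MeasurableSpace (RCG M) := borel _
instance : BorelSpace (RCG M) := ⟨rfl⟩


/-! ### The `d`-regular tree `T_d` -/

/-- A list `l = [i_k, …, i_1]` (deepest step first) is the breadth-first-search label of a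
vertex of the `d`-regular tree `T_d` iff its first (root-side) step lies in `{1, …, d}` and all
subsequent steps lie in `{1, …, d-1}`. -/
def ValidTd (d : ℕ) (l : List ℕ) : Prop :=
  (∀ i ∈ l.dropLast, 1 ≤ i ∧ i ≤ d - 1) ∧ (∀ i ∈ l.getLast?, 1 ≤ i ∧ i ≤ d)

/-- The vertex set of the `d`-regular tree `T_d`. -/
def TdVertex (d : ℕ) : Type := {l : List ℕ // ValidTd d l}

/-- The root `o` of `T_d`. -/
def rootTd (d : ℕ) : TdVertex d := ⟨[], by constructor <;> simp [List.getLast?]⟩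

/-- The first neighbor `1` of the root of `T_d` (defined as the root for the degenerate case
`d = 0`, which never occurs below). -/
def node1 (d : ℕ) : TdVertex d :=
  if h : 1 ≤ d then ⟨[1], by constructor <;> simp [List.getLast?, h]⟩ else rootTd d

/-- The graph structure of the `d`-regular tree: two vertices are adjacent iff one is obtained
from the other by adding one step. -/
def TdGraph (d : ℕ) : SimpleGraph (TdVertex d) where
  Adj v w := (∃ i, w.1 = i :: v.1) ∨ (∃ i, v.1 = i :: w.1)
  symm := ⟨by intro v w h; tauto⟩
  loopless := ⟨by
    rintro v (⟨i, h⟩ | ⟨i, h⟩) <;>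
      · have := congrArg List.length h
        simp at this⟩

/-- Graph distance between two vertices of a tree encoded by their BFS labels: the nearest
common ancestor corresponds to the longest common suffix. -/
def treeDist (u w : List ℕ) : ℕ :=
  ((u.reverse.zip w.reverse).takeWhile (fun p => p.1 = p.2)).length |> fun c =>
    (u.length - c) + (w.length - c)

/-- The ball `S_r = B_r(o)` of radius `r` around the root of `T_d`. -/
def SrSet (d r : ℕ) : Set (TdVertex d) := {v | v.1.length ≤ r}

/-- The set `E_r = B_{r-1}({o,1})` of vertices at distance at most `r-1` from the edge `{o,1}`
of `T_d` (for `r ≥ 1`). -/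
def ErSet (d r : ℕ) : Set (TdVertex d) :=
  {v | v.1.length + 1 ≤ r ∨ (v.1.getLast? = some 1 ∧ v.1.length ≤ r)}

lemma ErSet_subset_SrSet (d r : ℕ) : ErSet d r ⊆ SrSet d r := by
  rintro v (h | ⟨-, h⟩) <;> simp only [SrSet, Set.mem_setOf_eq] <;> omega

/-! ### Invariant processes on `T_d` and their entropies -/

variable (d : ℕ) (M : Type*)

/-- `I_d(M)`: the set of probability measures on `M^{T_d}` invariant under all automorphisms
of the tree `T_d`. -/
def InvMeas [MeasurableSpace M] : Set (Measure (TdVertex d → M)) :=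
  {μ | IsProbabilityMeasure μ ∧
    ∀ φ : TdGraph d ≃g TdGraph d, μ.map (fun x => fun v => x (φ v)) = μ}

variable {d M}

/-- The Shannon entropy of (the distribution of) a random variable with law `μ`, a measure
with countable support on a discrete space. -/
def shannon {α : Type*} [MeasurableSpace α] (μ : Measure α) : ℝ :=
  ∑' a : α, Real.negMulLog (μ {a}).toReal

/-- The restriction `X_S` of a process `X` on `T_d` to a subset `S` of the vertices:
the pushforward of its law. -/
def restrictTo [MeasurableSpace M] (S : Set (TdVertex d))
    (μ : Measure (TdVertex d → M)) : Measure (↥S → M) :=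
  μ.map (fun x => fun v => x v.1)

/-- The annealed entropy `Σ_r(μ) = H(X_{S_r}) - (d/2) H(X_{E_r})`. -/
def SigmaR [MeasurableSpace M] (d : ℕ) (r : ℕ) (μ : Measure (TdVertex d → M)) : ℝ :=
  shannon (restrictTo (SrSet d r) μ) - (d / 2 : ℝ) * shannon (restrictTo (ErSet d r) μ)

/-- The annealed entropy `Σ(μ) = lim_r Σ_r(μ)`: the limit of the non-increasing sequence
`r ↦ Σ_r(μ)` (`r ≥ 1`), as an extended real (the limit may be `-∞`). -/
def SigmaInf [MeasurableSpace M] (d : ℕ) (μ : Measure (TdVertex d → M)) : EReal :=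
  ⨅ r : ℕ, ((SigmaR d (r + 1) μ : ℝ) : EReal)

/-- `Σ_e(X) = (d/2) H(X_{E_1}) - (d-1) H(X_o)`. -/
def SigmaE [MeasurableSpace M] (d : ℕ) (μ : Measure (TdVertex d → M)) : ℝ :=
  (d / 2 : ℝ) * shannon (restrictTo (ErSet d 1) μ)
    - ((d : ℝ) - 1) * shannon (restrictTo ({rootTd d} : Set (TdVertex d)) μ)

/-! ### Markov processes on `T_d` -/

/-- The elementary cylinder event: the coloring takes the values prescribed by `y` on `S`. -/
def cylEvent (S : Set (TdVertex d)) (y : TdVertex d → M) : Set (TdVertex d → M) :=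
  {x | ∀ v ∈ S, x v = y v}

/-- The side of the edge `{u,w}` containing `u`, in the tree `T_d`. -/
def sideOf (u w : TdVertex d) : Set (TdVertex d) :=
  {v | treeDist v.1 u.1 < treeDist v.1 w.1}

/-- `B_{r-1}({u,w})`: the set of vertices at distance at most `r-1` from the edge `{u,w}`. -/
def edgeBall (r : ℕ) (u w : TdVertex d) : Set (TdVertex d) :=
  {v | treeDist v.1 u.1 + 1 ≤ r ∨ treeDist v.1 w.1 + 1 ≤ r}

/-- A probability measure on `M^{T_d}` is `r`-Markov on a subset `A` of `T_d` if, for every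
edge `{u,w}` of `A`, conditioned on the value on the `(r-1)`-neighborhood of the edge
(within `A`), the processes on the two sides of the edge (within `A`) are independent;
equivalently, the corresponding products of cylinder probabilities agree.  For `A` the whole
tree and `r = 1` this is the edge-Markov property. -/
def rMarkovOn [MeasurableSpace M] (r : ℕ) (A : Set (TdVertex d))
    (μ : Measure (TdVertex d → M)) : Prop :=
  ∀ u w : TdVertex d, u ∈ A → w ∈ A → (TdGraph d).Adj u w →
    ∀ F₁ F₂ : Finset (TdVertex d), ↑F₁ ⊆ sideOf u w ∩ A → ↑F₂ ⊆ sideOf w u ∩ A →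
      ∀ y : TdVertex d → M,
        μ (cylEvent (↑F₁ ∪ ↑F₂ ∪ (edgeBall r u w ∩ A)) y)
            * μ (cylEvent (edgeBall r u w ∩ A) y)
          = μ (cylEvent (↑F₁ ∪ (edgeBall r u w ∩ A)) y)
            * μ (cylEvent (↑F₂ ∪ (edgeBall r u w ∩ A)) y)

/-- A probability measure on `M^{T_d}` is `r`-Markov if, conditioned on the value on the
`(r-1)`-neighborhood of any edge, the processes on the two sides of the edge are
independent. -/
def rMarkov [MeasurableSpace M] (r : ℕ) (μ : Measure (TdVertex d → M)) : Prop :=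
  rMarkovOn r Set.univ μ

/-- A probability measure on `M^{T_d}` is vertex-Markov if, conditioned on the value at a
vertex, the processes on the pending subtrees of that vertex are independent. -/
def vertexMarkov [MeasurableSpace M] (μ : Measure (TdVertex d → M)) : Prop :=
  ∀ v : TdVertex d, ∀ k : ℕ, ∀ u : Fin k → TdVertex d,
    Function.Injective u → (∀ i, (TdGraph d).Adj v (u i)) →
    ∀ F : Fin k → Finset (TdVertex d), (∀ i, ↑(F i) ⊆ sideOf (u i) v) →
      ∀ y : TdVertex d → M,
        μ (cylEvent ((⋃ i, ↑(F i)) ∪ {v}) y) * (μ (cylEvent {v} y)) ^ (k - 1)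
          = ∏ i : Fin k, μ (cylEvent (↑(F i) ∪ {v}) y)

/-- `X_{S_1}` is a vertex-Markov process on `S_1`: the values at the `d` neighbors of the
root are conditionally independent given the value at the root. -/
def vertexMarkovOnS1 [MeasurableSpace M] (d : ℕ) (μ : Measure (TdVertex d → M)) : Prop :=
  ∀ y : TdVertex d → M,
    μ (cylEvent (SrSet d 1) y) * (μ (cylEvent ({rootTd d} : Set (TdVertex d)) y)) ^ (d - 1)
      = ∏ i ∈ Finset.Icc 1 d,
          μ (cylEvent {v : TdVertex d | v = rootTd d ∨ v.1 = [i]} y)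


/-! ### The randomly labeled rooted colored graph associated to a finite colored graph

Given a finite colored graph `(G,f)` and a vertex `v`, the associated randomly labeled rooted
colored graph is obtained by a breadth-first search exploration of the connected component of
`v` started at `v`, ties between vertices being broken uniformly at random.  We implement the
uniformly random tie-breaking by a uniformly random priority permutation `σ`. -/

variable {M : Type*} {n : ℕ}

/-- The `k`-th layer of the breadth-first search of `G` started at `v`, ordered according to
the position of the parents in the previous layer, ties being broken by the priority `σ`. -/
def bfsLayer (G : SimpleGraph (Fin n)) (v : Fin n) (σ : Equiv.Perm (Fin n)) :
    ℕ → List (Fin n)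
  | 0 => [v]
  | (k + 1) =>
    let prev := bfsLayer G v σ k
    let key : Fin n → ℕ := fun w =>
      (prev.idxOf (((prev.find? (fun u => decide (G.Adj u w))).getD v))) * n + (σ w : ℕ)
    ((List.finRange n).filter
        (fun w => decide (G.Reachable v w ∧ G.dist v w = k + 1))).mergeSort
      (fun a b => key a ≤ key b)

/-- The breadth-first-search label of the vertex `w` lying in layer `k` of the exploration of
`G` started at `v` with tie-breaking priority `σ`. -/
def bfsPathAux (G : SimpleGraph (Fin n)) (v : Fin n) (σ : Equiv.Perm (Fin n)) :
    ℕ → Fin n → Option (List ℕ)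
  | 0, w => if w = v then some [] else none
  | (k + 1), w =>
    match (bfsLayer G v σ k).find? (fun u => decide (G.Adj u w)) with
    | none => none
    | some p =>
      let L := bfsLayer G v σ (k + 1)
      let j := 1 + ((L.takeWhile (fun w' => w' ≠ w)).filter
        (fun w' => (bfsLayer G v σ k).find? (fun u => decide (G.Adj u w')) = some p)).length
      (bfsPathAux G v σ k p).map (fun pl => j :: pl)

/-- The breadth-first-search label of the vertex `w` in the exploration of the connected
component of `v` in `G`, with tie-breaking priority `σ` (`none` if `w` is not in the component
of `v`). -/
def bfsPath (G : SimpleGraph (Fin n)) (v : Fin n) (σ : Equiv.Perm (Fin n)) (w : Fin n) :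
    Option (List ℕ) :=
  if G.Reachable v w then bfsPathAux G v σ (G.dist v w) w else none

/-- The rooted colored graph obtained from the colored graph `(G,f)` by the breadth-first
search exploration of the connected component of `v` rooted at `v`, with tie-breaking
priority `σ`. -/
def bfsRCG (G : SimpleGraph (Fin n)) (f : Fin n → M) (v : Fin n) (σ : Equiv.Perm (Fin n)) :
    RCG M where
  col l := if h : ∃ w, bfsPath G v σ w = some l then some (f h.choose) else none
  adj p :=
    if (∃ w₁ w₂, bfsPath G v σ w₁ = some p.1 ∧ bfsPath G v σ w₂ = some p.2 ∧ G.Adj w₁ w₂)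
    then true else false

/-- `distr_{G,v}(f)`: the law of the randomly labeled rooted colored graph obtained from the
connected component of `v` in the colored graph `(G,f)`, rooted at `v`. -/
def distrAt (G : SimpleGraph (Fin n)) (f : Fin n → M) (v : Fin n) : Measure (RCG M) :=
  ((Nat.factorial n : ℝ≥0∞))⁻¹ •
    ∑ σ : Equiv.Perm (Fin n), Measure.dirac (bfsRCG G f v σ)

/-- `distr_G(f) = (1/|V|) ∑_{v ∈ V} distr_{G,v}(f)`. -/
def distrG (G : SimpleGraph (Fin n)) (f : Fin n → M) : Measure (RCG M) :=
  ((n : ℝ≥0∞))⁻¹ • ∑ v : Fin n, distrAt G f v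

/-! ### Random regular graphs -/

/-- The set `𝓖_n(d)` of simple `d`-regular graphs on the vertex set `{1, …, n}`. -/
def regularGraphs (d n : ℕ) : Set (SimpleGraph (Fin n)) :=
  {G | ∀ v, (G.neighborSet v).ncard = d}

/-- The probability that a uniformly distributed random `d`-regular graph `G_n` on `n`
vertices belongs to `A`. -/
def PrG (d n : ℕ) (A : Set (SimpleGraph (Fin n))) : ℝ :=
  ((regularGraphs d n ∩ A).ncard : ℝ) / ((regularGraphs d n).ncard : ℝ)

/-- The expectation of `F(G_n)` for a uniformly distributed random `d`-regular graph `G_n`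
on `n` vertices. -/
def ExG (d n : ℕ) (F : SimpleGraph (Fin n) → ℝ) : ℝ :=
  (∑ᶠ G ∈ regularGraphs d n, F G) / ((regularGraphs d n).ncard : ℝ)

/-- The integers `n` for which the set of simple `d`-regular graphs on `n` vertices is
non-empty: `n ≥ d + 1` and `nd` even.  Limits `n → ∞` are taken along this set. -/
def goodN (d : ℕ) : Set ℕ := {n | d + 1 ≤ n ∧ Even (n * d)}

/-- The filter `n → ∞` along `{n : n ≥ d+1, nd even}`. -/
def goodFilter (d : ℕ) : Filter ℕ := Filter.atTop ⊓ Filter.principal (goodN d)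

/-! ### The embedding of invariant processes into rooted colored graphs -/

/-- The rooted colored graph `(T_d, x, o)` associated to a coloring `x` of `T_d` (the
canonical labeling of `T_d` is a breadth-first-search labeling; for an invariant process the
resulting law is that of the randomly labeled rooted colored graph). -/
def iotaTd (d : ℕ) (x : TdVertex d → M) : RCG M where
  col l := if h : ValidTd d l then some (x ⟨l, h⟩) else none
  adj p :=
    if (ValidTd d p.1 ∧ ValidTd d p.2 ∧ ((∃ i, p.2 = i :: p.1) ∨ (∃ i, p.1 = i :: p.2)))
    then true else false

/-- The law, as a probability measure on rooted colored graphs, of the randomly labeled rooted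
colored tree `(T_d, X, o)` where `X` has law `μ`. -/
def lawTd (d : ℕ) [MeasurableSpace M] (μ : Measure (TdVertex d → M)) : Measure (RCG M) :=
  μ.map (iotaTd d)

/-! ### Micro-state (sofic) entropy -/

/-- `𝓕_G(μ,r,ε)`: the set of colorings `f` of `G` whose radius-`r` local statistics are
`ε`-close (in the Lévy-Prokhorov distance, which generates the weak topology) to the
radius-`r` restriction of `μ`. -/
def FSet (d : ℕ) [MeasurableSpace M] (μ : Measure (TdVertex d → M)) (r : ℕ) (ε : ℝ)
    (G : SimpleGraph (Fin n)) : Set (Fin n → M) :=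
  {f | levyProkhorovDist ((distrG G f).map (resS r)) ((lawTd d μ).map (resS r)) ≤ ε}

/-- `H_{G}(μ,r,ε) = (1/n) log |𝓕_G(μ,r,ε)| ∈ {-∞} ∪ [0,∞)`. -/
def HG (d : ℕ) [MeasurableSpace M] (μ : Measure (TdVertex d → M)) (r : ℕ) (ε : ℝ)
    (G : SimpleGraph (Fin n)) : EReal :=
  if FSet d μ r ε G = ∅ then ⊥
  else ((Real.log ((FSet d μ r ε G).ncard) / n : ℝ) : EReal)

/-- `h_n(μ,r,ε,α)`: the `α`-quantile
`sup { h ∈ {-∞} ∪ [0,∞) : ℙ(H_{G_n}(μ,r,ε) ≥ h) ≥ α }`. -/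
def hquant (d : ℕ) [MeasurableSpace M] (μ : Measure (TdVertex d → M)) (r : ℕ) (ε : ℝ)
    (α : ℝ) (n : ℕ) : EReal :=
  sSup {h : EReal | (h = ⊥ ∨ 0 ≤ h) ∧
    α ≤ PrG d n {G : SimpleGraph (Fin n) | h ≤ HG d μ r ε G}}

/-- The upper entropy `h̄(μ,r,α) = lim_{ε → 0} limsup_n h_n(μ,r,ε,α)` (the limit over `ε`
of a quantity non-decreasing in `ε`, i.e. the infimum over `ε > 0`). -/
def hbarA (d : ℕ) [MeasurableSpace M] (μ : Measure (TdVertex d → M)) (r : ℕ) (α : ℝ) :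
    EReal :=
  ⨅ ε : {e : ℝ // 0 < e}, (goodFilter d).limsup (fun n => hquant d μ r ε.1 α n)

/-- The lower entropy `h̲(μ,r,α) = lim_{ε → 0} liminf_n h_n(μ,r,ε,α)`. -/
def hlowA (d : ℕ) [MeasurableSpace M] (μ : Measure (TdVertex d → M)) (r : ℕ) (α : ℝ) :
    EReal :=
  ⨅ ε : {e : ℝ // 0 < e}, (goodFilter d).liminf (fun n => hquant d μ r ε.1 α n)

/-- `h̄(μ,r)`: the common value of `h̄(μ,r,α)`, `0 < α < 1`. -/
def hbarR (d : ℕ) [MeasurableSpace M] (μ : Measure (TdVertex d → M)) (r : ℕ) : EReal :=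
  hbarA d μ r (1 / 2)

/-- `h̲(μ,r)`: the common value of `h̲(μ,r,α)`, `0 < α < 1`. -/
def hlowR (d : ℕ) [MeasurableSpace M] (μ : Measure (TdVertex d → M)) (r : ℕ) : EReal :=
  hlowA d μ r (1 / 2)

/-- The upper sofic entropy `h̄(μ) = lim_{r → ∞} h̄(μ,r)` (the limit of a non-increasing
sequence, i.e. the infimum over `r`). -/
def hbar (d : ℕ) [MeasurableSpace M] (μ : Measure (TdVertex d → M)) : EReal :=
  ⨅ r : ℕ, hbarR d μ r

/-- The lower sofic entropy `h̲(μ) = lim_{r → ∞} h̲(μ,r)`. -/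
def hlow (d : ℕ) [MeasurableSpace M] (μ : Measure (TdVertex d → M)) : EReal :=
  ⨅ r : ℕ, hlowR d μ r

/-! ### Typical processes -/

/-- The probability that the random `d`-regular graph `G_n` admits a coloring whose local
statistics are `ε`-close to `μ`. -/
def typicalPr (d : ℕ) [MeasurableSpace M] (μ : Measure (TdVertex d → M)) (ε : ℝ) (n : ℕ) :
    ℝ :=
  PrG d n {G : SimpleGraph (Fin n) |
    ∃ f : Fin n → M, levyProkhorovDist (distrG G f) (lawTd d μ) ≤ ε}

/-- `μ ∈ I_d(M)` is weakly typical if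
`lim_{ε → 0} limsup_{n → ∞} ℙ(∃ f : d(distr_{G_n}(f), μ) ≤ ε) = 1`. -/
def WeaklyTypical (d : ℕ) [MeasurableSpace M] (μ : Measure (TdVertex d → M)) : Prop :=
  Tendsto (fun ε => (goodFilter d).limsup (fun n => typicalPr d μ ε n))
    (nhdsWithin 0 (Set.Ioi 0)) (nhds 1)

/-- `μ ∈ I_d(M)` is strongly typical if
`lim_{ε → 0} lim_{n → ∞} ℙ(∃ f : d(distr_{G_n}(f), μ) ≤ ε) = 1` (in particular the inner
limits along `n → ∞` exist). -/
def StronglyTypical (d : ℕ) [MeasurableSpace M] (μ : Measure (TdVertex d → M)) : Prop :=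
  ∃ L : ℝ → ℝ,
    (∀ ε : ℝ, 0 < ε → Tendsto (fun n => typicalPr d μ ε n) (goodFilter d) (nhds (L ε))) ∧
    Tendsto L (nhdsWithin 0 (Set.Ioi 0)) (nhds 1)


/-! ### Processes on balls of `T_d` and the sets `I_{d,r}(M)`, `I_e(M)` -/

/-- The ball `S_r` of `T_d` as an induced subgraph. -/
def SrGraph (d r : ℕ) : SimpleGraph ↥(SrSet d r) := (TdGraph d).induce (SrSet d r)

/-- The set `E_r` of `T_d` as an induced subgraph. -/
def ErGraph (d r : ℕ) : SimpleGraph ↥(ErSet d r) := (TdGraph d).induce (ErSet d r)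

lemma root_mem_Er (d r : ℕ) (hr : 1 ≤ r) : rootTd d ∈ ErSet d r := by
  left; simpa [rootTd] using hr

lemma node1_mem_Er (d r : ℕ) (hr : 1 ≤ r) : node1 d ∈ ErSet d r := by
  by_cases h : 1 ≤ d
  · right
    constructor <;> simp [node1, h, List.getLast?, hr]
  · simpa [node1, h] using root_mem_Er d r hr

variable {M : Type*}

/-- The restriction to `E_r ⊆ S_r` of a probability measure on `M^{S_r}`. -/
def restrictErOfSr [MeasurableSpace M] (d r : ℕ) (p : Measure (↥(SrSet d r) → M)) :
    Measure (↥(ErSet d r) → M) :=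
  p.map (fun x => fun v : ↥(ErSet d r) => x ⟨v.1, ErSet_subset_SrSet d r v.2⟩)

/-- `I_{d,r}(M)`: the set of probability measures on `M^{S_r}` which are invariant under the
automorphisms of `S_r` and whose restriction to `E_r` is invariant under switching the two
sides of the edge `{o,1}`. -/
def IdrMeas (d r : ℕ) (M : Type*) [MeasurableSpace M] :
    Set (Measure (↥(SrSet d r) → M)) :=
  {p | IsProbabilityMeasure p ∧
    (∀ φ : SrGraph d r ≃g SrGraph d r, p.map (fun x => fun v => x (φ v)) = p) ∧
    (∀ ψ : ErGraph d r ≃g ErGraph d r,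
      (∀ hv : rootTd d ∈ ErSet d r, ((ψ ⟨rootTd d, hv⟩ : ↥(ErSet d r)) : TdVertex d) = node1 d) →
      (restrictErOfSr d r p).map (fun x => fun v => x (ψ v)) = restrictErOfSr d r p)}

/-- The annealed entropy `Σ(p) = H(X_{S_r}) - (d/2) H(X_{E_r})` of `p ∈ I_{d,r}(M)`. -/
def SigmaP [MeasurableSpace M] (d r : ℕ) (p : Measure (↥(SrSet d r) → M)) : ℝ :=
  shannon p - (d / 2 : ℝ) * shannon (restrictErOfSr d r p)

/-- The involution of `E_1 = {o, 1}` switching the two sides of the edge `{o,1}`. -/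
def swapE1 (d : ℕ) : ↥(ErSet d 1) → ↥(ErSet d 1) := fun v =>
  if (v : TdVertex d) = rootTd d then ⟨node1 d, node1_mem_Er d 1 le_rfl⟩
  else ⟨rootTd d, root_mem_Er d 1 le_rfl⟩

/-- `I_e(M)`: the set of probability measures on `M^{E_1}` invariant under switching the two
sides of the edge `{o,1}`. -/
def IeMeas (d : ℕ) (M : Type*) [MeasurableSpace M] : Set (Measure (↥(ErSet d 1) → M)) :=
  {p | IsProbabilityMeasure p ∧ p.map (fun x => fun v => x (swapE1 d v)) = p}

/-- The annealed entropy `Σ(p) = (d/2) H(X_{E_1}) - (d-1) H(X_o)` of `p ∈ I_e(M)`. -/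
def SigmaPe [MeasurableSpace M] (d : ℕ) (p : Measure (↥(ErSet d 1) → M)) : ℝ :=
  (d / 2 : ℝ) * shannon p
    - ((d : ℝ) - 1) * shannon (p.map (fun x => x ⟨rootTd d, root_mem_Er d 1 le_rfl⟩))

/-! ### Factor graphs: functions of rooted unlabeled colored graphs of radius `r` -/

/-- The vertex set of a rooted colored graph. -/
def vertsOf (g : RCG M) : Set (List ℕ) := {l | g.col l ≠ none}

/-- An isomorphism of rooted colored graphs (a color- and adjacency-preserving bijection of
the vertex sets mapping root to root). -/
def RCGRootedIso (g g' : RCG M) : Prop :=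
  ∃ e : ↥(vertsOf g) ≃ ↥(vertsOf g'),
    (∀ v, g'.col ((e v) : List ℕ) = g.col (v : List ℕ)) ∧
    (∀ v w, g'.adj (((e v) : List ℕ), ((e w) : List ℕ)) = g.adj ((v : List ℕ), (w : List ℕ))) ∧
    (∀ h : [] ∈ vertsOf g, ∀ _ : [] ∈ vertsOf g', ((e ⟨[], h⟩) : List ℕ) = [])

/-- A function on rooted unlabeled colored graphs of radius `r`: a function of rooted colored
graphs which only depends on the isomorphism class of the ball of radius `r` around the
root. -/
def IsRadiusRFn (r : ℕ) (ψ : RCG M → ℝ) : Prop :=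
  ∀ g g' : RCG M, RCGRootedIso (resS r g) (resS r g') → ψ g = ψ g'

/-- The value `ψ((G,f,v)_r)` of `ψ` at the rooted unlabeled colored graph given by the ball of
radius `r` around `v` in `(G,f)` (computed as the average over the random labelings, which is
the constant value of `ψ` on them when `ψ` is a function of the unlabeled graph). -/
def psiAt {n : ℕ} (G : SimpleGraph (Fin n)) (f : Fin n → M) (v : Fin n) (ψ : RCG M → ℝ) :
    ℝ :=
  ∫ g, ψ g ∂(distrAt G f v)

/-- The partition function `Z_G = ∑_f ∏_v exp(ψ((G,f,v)_r))` of the factor model `ψ`. -/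
def ZG {n : ℕ} [Fintype M] (G : SimpleGraph (Fin n)) (ψ : RCG M → ℝ) : ℝ :=
  ∑ f : Fin n → M, Real.exp (∑ v : Fin n, psiAt G f v ψ)

/-- The ground-state energy `L_G = max_f ∑_v ψ((G,f,v)_r)`. -/
def LG {n : ℕ} (G : SimpleGraph (Fin n)) (ψ : RCG M → ℝ) : ℝ :=
  sSup {x : ℝ | ∃ f : Fin n → M, x = ∑ v : Fin n, psiAt G f v ψ}

/-- The canonical rooted colored graph associated to a coloring of the ball `S_r` of `T_d`. -/
def iotaSr (d r : ℕ) (x : ↥(SrSet d r) → M) : RCG M where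
  col l := if h : ValidTd d l ∧ l.length ≤ r then some (x ⟨⟨l, h.1⟩, h.2⟩) else none
  adj p := if (ValidTd d p.1 ∧ ValidTd d p.2 ∧ p.1.length ≤ r ∧ p.2.length ≤ r ∧
      ((∃ i, p.2 = i :: p.1) ∨ (∃ i, p.1 = i :: p.2))) then true else false

/-- `⟨p, ψ⟩ = E[ψ(X)]` where `X` has law `p ∈ I_{d,r}(M)`. -/
def pairing [MeasurableSpace M] (d r : ℕ) (p : Measure (↥(SrSet d r) → M))
    (ψ : RCG M → ℝ) : ℝ :=
  ∫ x, ψ (iotaSr d r x) ∂p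

/-! ### Annealed quantities for random regular graphs -/

/-- `log` with the convention `log 0 = -∞`, with values in the extended reals. -/
def elog (x : ℝ) : EReal := if x ≤ 0 then ⊥ else ((Real.log x : ℝ) : EReal)

/-- The set `𝓖_n(μ,r,ε)` of pairs `(G,f)` of a `d`-regular graph together with a coloring
whose radius-`r` local statistics are `ε`-close to `μ_r`. -/
def GnPairs (d : ℕ) [MeasurableSpace M] (μ : Measure (TdVertex d → M)) (r : ℕ) (ε : ℝ)
    (n : ℕ) : Set (SimpleGraph (Fin n) × (Fin n → M)) :=
  {Gf | Gf.1 ∈ regularGraphs d n ∧ Gf.2 ∈ FSet d μ r ε Gf.1}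

/-- The annealed entropy
`Σ_n(μ,r,ε) = (1/n) (log |𝓖_n(μ,r,ε)| - log |𝓖_n(d)|) = (1/n) log E |𝓕_{G_n}(μ,r,ε)|`. -/
def SigmaN (d : ℕ) [MeasurableSpace M] (μ : Measure (TdVertex d → M)) (r : ℕ) (ε : ℝ)
    (n : ℕ) : EReal :=
  (((n : ℝ)⁻¹ : ℝ) : EReal) *
    elog (((GnPairs d μ r ε n).ncard : ℝ) / ((regularGraphs d n).ncard : ℝ))

/-- The relaxed partition function `Z_G(β) = ∑_f exp(-nβ d(distr_G(f)_r, μ_r))`. -/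
def ZGbeta (d : ℕ) [MeasurableSpace M] {n : ℕ} [Fintype M] (μ : Measure (TdVertex d → M))
    (r : ℕ) (β : ℝ) (G : SimpleGraph (Fin n)) : ℝ :=
  ∑ f : Fin n → M, Real.exp (-(n : ℝ) * β *
    levyProkhorovDist ((distrG G f).map (resS r)) ((lawTd d μ).map (resS r)))


/-! ### Processes on unimodular Galton-Watson trees

A colored rooted tree `(T, X, o)` with `T` a subtree of the label set, rooted at `[]` and
with the children of a vertex `v` labeled `1 :: v, …, N_v :: v`, is encoded as a rooted
colored graph in `RCG M`. -/

/-- `g` is a canonically labeled colored rooted tree. -/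
def IsCanonTree (g : RCG M) : Prop :=
  g.col [] ≠ none ∧
  (∀ l : List ℕ, g.col l ≠ none → g.col l.tail ≠ none) ∧
  (∀ (v : List ℕ) (i : ℕ), 1 ≤ i → g.col ((i + 1) :: v) ≠ none → g.col (i :: v) ≠ none) ∧
  (∀ v : List ℕ, g.col (0 :: v) = none) ∧
  (∀ p : List ℕ × List ℕ, g.adj p = true ↔
    (g.col p.1 ≠ none ∧ g.col p.2 ≠ none ∧
      ((∃ i, p.2 = i :: p.1) ∨ (∃ i, p.1 = i :: p.2))))

/-- A finite canonically labeled tree. -/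
def IsFinTree (t : Finset (List ℕ)) : Prop :=
  [] ∈ t ∧ (∀ l ∈ t, l.tail ∈ t) ∧
  (∀ (v : List ℕ) (i : ℕ), 1 ≤ i → ((i + 1) :: v) ∈ t → (i :: v) ∈ t) ∧
  (∀ v : List ℕ, (0 :: v) ∉ t)

/-- The number of children of the vertex `v` in the finite tree `t`. -/
def childCountF (t : Finset (List ℕ)) (v : List ℕ) : ℕ :=
  (t.filter (fun w => w ≠ [] ∧ w.tail = v)).card

/-- The size-biased version `π̂(k) = (k+1) π(k+1) / d` of the offspring distribution `π`. -/
def sizeBiased (π : ℕ → ℝ) (dd : ℝ) (k : ℕ) : ℝ := (k + 1 : ℝ) * π (k + 1) / dd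

/-- The probability that the unimodular Galton-Watson tree with degree distribution `π`,
truncated at depth `k`, equals the finite tree `t`. -/
def treeWeight (π : ℕ → ℝ) (dd : ℝ) (k : ℕ) (t : Finset (List ℕ)) : ℝ :=
  π (childCountF t []) *
    ∏ v ∈ t.filter (fun v => v ≠ [] ∧ v.length < k), sizeBiased π dd (childCountF t v)

/-- The law of the underlying tree is the unimodular Galton-Watson law `UGW(π)`:
all finite-depth truncations have the prescribed distribution. -/
def IsUGWTreeLaw (π : ℕ → ℝ) (dd : ℝ) (μ : Measure (RCG M)) : Prop :=
  ∀ (k : ℕ) (t : Finset (List ℕ)), IsFinTree t → (∀ v ∈ t, v.length ≤ k) →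
    (μ {g | ∀ l : List ℕ, l.length ≤ k → (g.col l ≠ none ↔ l ∈ t)}).toReal
      = treeWeight π dd k t

/-- `e` realizes an isomorphism (not necessarily root-preserving) of the colored graphs `g`
and `g'`. -/
def IsIsoVia (g g' : RCG M) (e : List ℕ → List ℕ) : Prop :=
  Set.BijOn e (vertsOf g) (vertsOf g') ∧
  (∀ l ∈ vertsOf g, g'.col (e l) = g.col l) ∧
  (∀ l ∈ vertsOf g, ∀ l' ∈ vertsOf g, g'.adj (e l, e l') = g.adj (l, l'))

/-- A function on doubly rooted colored graphs, invariant under isomorphisms. -/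
def PairInvariant (F : RCG M → List ℕ → List ℕ → ℝ≥0∞) : Prop :=
  ∀ g g' e, IsIsoVia g g' e → ∀ u ∈ vertsOf g, ∀ v ∈ vertsOf g, F g' (e u) (e v) = F g u v

/-- Unimodularity (the mass-transport principle):
`E ∑_v F(G,o,v) = E ∑_v F(G,v,o)` for all isomorphism-invariant `F ≥ 0`. -/
def Unimodular (μ : Measure (RCG M)) : Prop :=
  ∀ F : RCG M → List ℕ → List ℕ → ℝ≥0∞, PairInvariant F →
    ∫⁻ g, (∑' v : ↥(vertsOf g), F g [] (v : List ℕ)) ∂μ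
      = ∫⁻ g, (∑' v : ↥(vertsOf g), F g (v : List ℕ) []) ∂μ

/-- `I_π(M)`: the laws of invariant (unimodular) processes `(T,X)` with colors in `M` over
the unimodular Galton-Watson tree with degree distribution `π` (of mean `dd`). -/
def IPiMeas (π : ℕ → ℝ) (dd : ℝ) (M : Type*) [MeasurableSpace M] :
    Set (Measure (RCG M)) :=
  {μ | IsProbabilityMeasure μ ∧ μ {g | IsCanonTree g} = 1 ∧ Unimodular μ ∧
    IsUGWTreeLaw π dd μ}

/-- The root degree `deg(o)` of a canonically labeled tree (the number of children of the
root). -/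
def rootDeg (g : RCG M) : ℕ := {i : ℕ | g.col [i] ≠ none}.ncard

/-- The edge-biased law `→μ(⬝) = (1/d) E[deg(o) 1{(T,X,(o,1)) ∈ ⬝}]` on colored edge-rooted
trees (the root edge being `([], [1])`). -/
def vecLaw (dd : ℝ) [MeasurableSpace M] (μ : Measure (RCG M)) : Measure (RCG M) :=
  (ENNReal.ofReal dd)⁻¹ • μ.withDensity (fun g => (rootDeg g : ℝ≥0∞))

/-- Membership in `E_r = B_{r-1}({o,1})` for a vertex of a canonically labeled tree. -/
def inErL (r : ℕ) (l : List ℕ) : Prop :=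
  l.length + 1 ≤ r ∨ (l.getLast? = some 1 ∧ l.length ≤ r)

/-- The restriction of a colored edge-rooted tree to `E_r = B_{r-1}({o,1})`. -/
def resE (r : ℕ) (g : RCG M) : RCG M where
  col l := if inErL r l then g.col l else none
  adj p := if inErL r p.1 ∧ inErL r p.2 then g.adj p else false

/-- The Shannon entropy `H(π)` of the probability mass function `π`. -/
def Hpmf (π : ℕ → ℝ) : ℝ := ∑' k : ℕ, Real.negMulLog (π k)

/-- The annealed entropy `Σ_r(μ) = H(X_{S_r}) - (d/2) H(→X_{E_r}) - H(π)` of an invariant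
process over the unimodular Galton-Watson tree. -/
def SigmaUGW (π : ℕ → ℝ) (dd : ℝ) [MeasurableSpace M] (r : ℕ) (μ : Measure (RCG M)) : ℝ :=
  shannon (μ.map (resS r)) - (dd / 2) * shannon ((vecLaw dd μ).map (resE r)) - Hpmf π

/-- `Σ(μ) = lim_{r → ∞} Σ_r(μ)` (the limit of a non-increasing sequence). -/
def SigmaUGWInf (π : ℕ → ℝ) (dd : ℝ) [MeasurableSpace M] (μ : Measure (RCG M)) : EReal :=
  ⨅ r : ℕ, ((SigmaUGW π dd (r + 1) μ : ℝ) : EReal)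

/-- `Σ_e(X) = (d/2) H(→X_{E_1}) - d H(→X_o) + H(X_o) - H(π)`. -/
def SigmaEUGW (π : ℕ → ℝ) (dd : ℝ) [MeasurableSpace M] (μ : Measure (RCG M)) : ℝ :=
  (dd / 2) * shannon ((vecLaw dd μ).map (resE 1))
    - dd * shannon ((vecLaw dd μ).map (resS 0))
    + shannon (μ.map (resS 0)) - Hpmf π

/-! ### Markov processes on random trees -/

/-- The side of the (potential) edge `{u,w}` containing `u`, among the labels. -/
def sideL (u w : List ℕ) : Set (List ℕ) := {v | treeDist v u < treeDist v w}

/-- `B_{r-1}({u,w})` among the labels. -/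
def edgeBallL (r : ℕ) (u w : List ℕ) : Set (List ℕ) :=
  {v | treeDist v u + 1 ≤ r ∨ treeDist v w + 1 ≤ r}

/-- The event that the tree structure agrees with that of `y` on `S` and that the colored
tree agrees with `y` on `B`. -/
def treeCylEvent (S B : Set (List ℕ)) (y : RCG M) : Set (RCG M) :=
  {g | (∀ l ∈ S, (g.col l ≠ none ↔ y.col l ≠ none)) ∧ (∀ l ∈ B, g.col l = y.col l)}

/-- A random colored tree is `r`-Markov on the ambient set `A` if, conditioned on the tree
and on the value on the `(r-1)`-neighborhood of an edge, the processes on the two sides of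
the edge are independent (conditioning on the tree is expressed through arbitrary finite
windows `S`). -/
def rMarkovTreeOn [MeasurableSpace M] (r : ℕ) (A : Set (List ℕ)) (μ : Measure (RCG M)) :
    Prop :=
  ∀ (u : List ℕ) (i : ℕ), 1 ≤ i → u ∈ A → (i :: u) ∈ A →
    ∀ F₁ F₂ : Finset (List ℕ), ↑F₁ ⊆ sideL u (i :: u) ∩ A → ↑F₂ ⊆ sideL (i :: u) u ∩ A →
    ∀ S : Finset (List ℕ), ↑S ⊆ A → ∀ y : RCG M,
      μ (treeCylEvent ↑S (edgeBallL r u (i :: u) ∩ A) y ∩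
          treeCylEvent ∅ ↑F₁ y ∩ treeCylEvent ∅ ↑F₂ y)
        * μ (treeCylEvent ↑S (edgeBallL r u (i :: u) ∩ A) y)
      = μ (treeCylEvent ↑S (edgeBallL r u (i :: u) ∩ A) y ∩ treeCylEvent ∅ ↑F₁ y)
        * μ (treeCylEvent ↑S (edgeBallL r u (i :: u) ∩ A) y ∩ treeCylEvent ∅ ↑F₂ y)

/-- A random colored tree is `r`-Markov if the above holds with ambient set everything. -/
def rMarkovTree [MeasurableSpace M] (r : ℕ) (μ : Measure (RCG M)) : Prop :=
  rMarkovTreeOn r Set.univ μ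

/-- A random colored tree is vertex-Markov on the ambient set `A` if, conditioned on the tree
and on the value at a vertex, the processes on the pending subtrees of that vertex are
independent. -/
def vertexMarkovTreeOn [MeasurableSpace M] (A : Set (List ℕ)) (μ : Measure (RCG M)) :
    Prop :=
  ∀ v ∈ A, ∀ (k : ℕ) (u : Fin k → List ℕ), Function.Injective u →
    (∀ j, u j ∈ A ∧ ((∃ i, 1 ≤ i ∧ u j = i :: v) ∨ (v ≠ [] ∧ u j = v.tail))) →
    ∀ F : Fin k → Finset (List ℕ), (∀ j, ↑(F j) ⊆ sideL (u j) v ∩ A) →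
    ∀ S : Finset (List ℕ), ↑S ⊆ A → ∀ y : RCG M,
      μ (treeCylEvent ↑S {v} y ∩ ⋂ j, treeCylEvent ∅ ↑(F j) y)
          * (μ (treeCylEvent ↑S {v} y)) ^ (k - 1)
        = ∏ j : Fin k, μ (treeCylEvent ↑S {v} y ∩ treeCylEvent ∅ ↑(F j) y)

/-- A random colored tree is vertex-Markov if the above holds with ambient set everything. -/
def vertexMarkovTree [MeasurableSpace M] (μ : Measure (RCG M)) : Prop :=
  vertexMarkovTreeOn Set.univ μ

/-! ### Random graphs with given degree sequences -/

/-- The set of simple graphs on `{1,…,n}` with degree sequence `dn`. -/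
def degSeqGraphs (n : ℕ) (dn : Fin n → ℕ) : Set (SimpleGraph (Fin n)) :=
  {G | ∀ v, (G.neighborSet v).ncard = dn v}

/-- The probability that a uniform random graph with degree sequence `dn` lies in `A`. -/
def PrD (n : ℕ) (dn : Fin n → ℕ) (A : Set (SimpleGraph (Fin n))) : ℝ :=
  ((degSeqGraphs n dn ∩ A).ncard : ℝ) / ((degSeqGraphs n dn).ncard : ℝ)

/-- `𝓕_G(μ,r,ε)` for a process `μ` over a unimodular Galton-Watson tree. -/
def FSetD [MeasurableSpace M] (μ : Measure (RCG M)) (r : ℕ) (ε : ℝ) {n : ℕ}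
    (G : SimpleGraph (Fin n)) : Set (Fin n → M) :=
  {f | levyProkhorovDist ((distrG G f).map (resS r)) (μ.map (resS r)) ≤ ε}

/-- `H_G(μ,r,ε) = (1/n) log |𝓕_G(μ,r,ε)|`. -/
def HGD [MeasurableSpace M] (μ : Measure (RCG M)) (r : ℕ) (ε : ℝ) {n : ℕ}
    (G : SimpleGraph (Fin n)) : EReal :=
  if FSetD μ r ε G = ∅ then ⊥
  else ((Real.log ((FSetD μ r ε G).ncard) / n : ℝ) : EReal)

/-- The `α`-quantile of `H_{G_n}(μ,r,ε)` for the uniform random graph with degree sequence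
`DN n`. -/
def hquantD [MeasurableSpace M] (DN : (n : ℕ) → Fin n → ℕ) (μ : Measure (RCG M)) (r : ℕ)
    (ε : ℝ) (α : ℝ) (n : ℕ) : EReal :=
  sSup {h : EReal | (h = ⊥ ∨ 0 ≤ h) ∧
    α ≤ PrD n (DN n) {G : SimpleGraph (Fin n) | h ≤ HGD μ r ε G}}

/-- `h̄(μ,r,α)` for the degree-sequence ensemble. -/
def hbarAD [MeasurableSpace M] (DN : (n : ℕ) → Fin n → ℕ) (μ : Measure (RCG M)) (r : ℕ)
    (α : ℝ) : EReal :=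
  ⨅ ε : {e : ℝ // 0 < e}, Filter.atTop.limsup (fun n => hquantD DN μ r ε.1 α n)

/-- `h̲(μ,r,α)` for the degree-sequence ensemble. -/
def hlowAD [MeasurableSpace M] (DN : (n : ℕ) → Fin n → ℕ) (μ : Measure (RCG M)) (r : ℕ)
    (α : ℝ) : EReal :=
  ⨅ ε : {e : ℝ // 0 < e}, Filter.atTop.liminf (fun n => hquantD DN μ r ε.1 α n)

/-- `h̄(μ,r)`: the common value of `h̄(μ,r,α)`, `0 < α < 1`. -/
def hbarRD [MeasurableSpace M] (DN : (n : ℕ) → Fin n → ℕ) (μ : Measure (RCG M)) (r : ℕ) :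
    EReal :=
  hbarAD DN μ r (1 / 2)

/-- `h̲(μ,r)`. -/
def hlowRD [MeasurableSpace M] (DN : (n : ℕ) → Fin n → ℕ) (μ : Measure (RCG M)) (r : ℕ) :
    EReal :=
  hlowAD DN μ r (1 / 2)

/-- The upper sofic entropy `h̄(μ) = lim_{r → ∞} h̄(μ,r)`. -/
def hbarD [MeasurableSpace M] (DN : (n : ℕ) → Fin n → ℕ) (μ : Measure (RCG M)) : EReal :=
  ⨅ r : ℕ, hbarRD DN μ r

/-- The lower sofic entropy `h̲(μ) = lim_{r → ∞} h̲(μ,r)`. -/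
def hlowD [MeasurableSpace M] (DN : (n : ℕ) → Fin n → ℕ) (μ : Measure (RCG M)) : EReal :=
  ⨅ r : ℕ, hlowRD DN μ r

/-- The hypotheses on the degree sequences: uniformly bounded by `Δ`, even sums, and
empirical distributions converging (weakly) to `π`. -/
def GoodDegSeq (π : ℕ → ℝ) (Δ : ℝ) (DN : (n : ℕ) → Fin n → ℕ) : Prop :=
  (∀ n v, (DN n v : ℝ) ≤ Δ) ∧ (∀ n, Even (∑ v : Fin n, DN n v)) ∧
  (∀ k : ℕ, Tendsto (fun n => (((Finset.univ.filter (fun v : Fin n => DN n v = k)).card : ℝ) / n))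
    atTop (nhds (π k)))

/-- The hypotheses on the degree distribution `π`: a probability mass function supported in
`{0,…,Δ}` with mean `dd > 0`. -/
def GoodPmf (π : ℕ → ℝ) (Δ : ℝ) (dd : ℝ) : Prop :=
  (∀ k, 0 ≤ π k) ∧ (∑' k : ℕ, π k) = 1 ∧ (∀ k : ℕ, (Δ : ℝ) < k → π k = 0) ∧
  (∑' k : ℕ, (k : ℝ) * π k) = dd ∧ 0 < dd


/-! ### Couplings -/

/-- `ν ∈ I_d(M × M)` is an invariant coupling of `μ` with itself: both coordinate marginal
processes of `ν` have law `μ`. -/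
def IsInvCoupling (d : ℕ) {M : Type*} [MeasurableSpace M] (μ : Measure (TdVertex d → M))
    (ν : Measure (TdVertex d → M × M)) : Prop :=
  ν ∈ InvMeas d (M × M) ∧ ν.map (fun x => fun v => (x v).1) = μ ∧
    ν.map (fun x => fun v => (x v).2) = μ

/-- The first coordinate marginal of a colored graph with colors in a product set. -/
def rcgFst {M₁ M₂ : Type*} (g : RCG (M₁ × M₂)) : RCG M₁ :=
  ⟨fun l => (g.col l).map Prod.fst, g.adj⟩

/-- The second coordinate marginal of a colored graph with colors in a product set. -/
def rcgSnd {M₁ M₂ : Type*} (g : RCG (M₁ × M₂)) : RCG M₂ :=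
  ⟨fun l => (g.col l).map Prod.snd, g.adj⟩

/-- `ν ∈ I_π(M × M)` is an invariant coupling of `μ ∈ I_π(M)` with itself. -/
def IsInvCouplingUGW (π : ℕ → ℝ) (dd : ℝ) {M : Type*} [MeasurableSpace M]
    (μ : Measure (RCG M)) (ν : Measure (RCG (M × M))) : Prop :=
  ν ∈ IPiMeas π dd (M × M) ∧ ν.map rcgFst = μ ∧ ν.map rcgSnd = μ


/-! ### Cylinder events and sums over the values on a finite set of vertices -/

instance (d : ℕ) : Countable (TdVertex d) := inferInstanceAs (Countable {l : List ℕ // ValidTd d l})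

/-- The sum of `f` over all the colorings obtained from `y` by changing its values on `t`. -/
def fiberSum {d : ℕ} {M : Type} [Fintype M] (t : Finset (TdVertex d))
    (f : (TdVertex d → M) → ℝ≥0∞) (y : TdVertex d → M) : ℝ≥0∞ :=
  ∑ z : t → M, f (Function.updateFinset y t z)

lemma measurableSet_forall_eq {ι : Type*} [Countable ι] {M : Type} [MeasurableSpace M]
    [DiscreteMeasurableSpace M] (C : Set ι) (y : ι → M) :
    MeasurableSet {x : ι → M | ∀ v ∈ C, x v = y v} := by
  have h : {x : ι → M | ∀ v ∈ C, x v = y v} = ⋂ v ∈ C, (fun x : ι → M => x v) ⁻¹' {y v} := by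
    ext x; simp
  rw [h]
  exact MeasurableSet.biInter C.to_countable
    fun v _ => measurable_pi_apply v (MeasurableSet.of_discrete)

lemma measurableSet_cylEvent {d : ℕ} {M : Type} [MeasurableSpace M] [DiscreteMeasurableSpace M]
    (S : Set (TdVertex d)) (y : TdVertex d → M) : MeasurableSet (cylEvent S y) :=
  measurableSet_forall_eq S y

lemma cylEvent_congr {d : ℕ} {M : Type} {S : Set (TdVertex d)} {y y' : TdVertex d → M}
    (h : ∀ v ∈ S, y v = y' v) : cylEvent S y = cylEvent S y' := by
  ext x
  exact forall₂_congr fun v hv => by rw [h v hv]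

lemma cylEvent_anti {d : ℕ} {M : Type} {S T : Set (TdVertex d)} (h : S ⊆ T)
    (y : TdVertex d → M) : cylEvent T y ⊆ cylEvent S y :=
  fun _ hx v hv => hx v (h hv)

lemma dependsOn_cylEvent {d : ℕ} {M : Type} [MeasurableSpace M]
    (μ : Measure (TdVertex d → M)) (S : Set (TdVertex d)) :
    DependsOn (fun y => μ (cylEvent S y)) S :=
  fun _ _ h => by simp only [cylEvent_congr h]

lemma fiberSum_empty {d : ℕ} {M : Type} [Fintype M]
    (f : (TdVertex d → M) → ℝ≥0∞) (y : TdVertex d → M) : fiberSum ∅ f y = f y := by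
  simp [fiberSum]

lemma fiberSum_union {d : ℕ} {M : Type} [Fintype M] {s t : Finset (TdVertex d)}
    (hst : Disjoint s t) (f : (TdVertex d → M) → ℝ≥0∞) (y : TdVertex d → M) :
    fiberSum (s ∪ t) f y = fiberSum s (fiberSum t f) y := by
  unfold fiberSum
  rw [← (Equiv.piFinsetUnion (fun _ => M) hst).sum_comp, Fintype.sum_prod_type]
  refine Finset.sum_congr rfl fun a _ => Finset.sum_congr rfl fun b _ => ?_
  rw [← Function.updateFinset_updateFinset hst]

lemma fiberSum_union_mul {d : ℕ} {M : Type} [Fintype M] {s t : Finset (TdVertex d)}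
    (hst : Disjoint s t) {S T : Set (TdVertex d)} (hSt : Disjoint S ↑t) (hTs : Disjoint T ↑s)
    {f g : (TdVertex d → M) → ℝ≥0∞} (hf : DependsOn f S) (hg : DependsOn g T)
    (y : TdVertex d → M) :
    fiberSum (s ∪ t) (fun y => f y * g y) y = fiberSum s f y * fiberSum t g y := by
  rw [fiberSum_union hst]
  unfold fiberSum
  rw [Finset.sum_mul_sum]
  refine Finset.sum_congr rfl fun a _ => Finset.sum_congr rfl fun b _ => ?_
  refine congrArg₂ (· * ·) ?_ ?_
  · refine hf fun v hv => ?_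
    have : v ∉ t := fun h => Set.disjoint_left.1 hSt hv h
    simp [Function.updateFinset, this]
  · refine hg fun v hv => ?_
    have : v ∉ s := fun h => Set.disjoint_left.1 hTs hv h
    simp [Function.updateFinset, this]

lemma fiberSum_mul_left {d : ℕ} {M : Type} [Fintype M] {t : Finset (TdVertex d)}
    {S : Set (TdVertex d)} (hSt : Disjoint S ↑t)
    {f g : (TdVertex d → M) → ℝ≥0∞} (hf : DependsOn f S) (y : TdVertex d → M) :
    fiberSum t (fun y => f y * g y) y = f y * fiberSum t g y := by
  have := fiberSum_union_mul (Finset.disjoint_empty_left t) hSt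
    (T := Set.univ) (by simp) hf (dependsOn_univ g) y
  rwa [Finset.empty_union, fiberSum_empty] at this

lemma fiberSum_cylEvent {d : ℕ} {M : Type} [Fintype M] [MeasurableSpace M]
    [DiscreteMeasurableSpace M] (μ : Measure (TdVertex d → M)) {S T : Finset (TdVertex d)}
    (h : S ⊆ T) (y : TdVertex d → M) :
    fiberSum (T \ S) (fun y => μ (cylEvent ↑T y)) y = μ (cylEvent ↑S y) := by
  have hU : cylEvent (↑S) y = ⋃ z ∈ (Finset.univ : Finset (↥(T \ S) → M)),
      cylEvent (↑T) (Function.updateFinset y (T \ S) z) := by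
    ext x
    simp only [Finset.mem_univ, Set.iUnion_true, Set.mem_iUnion, cylEvent, Finset.mem_coe,
      Set.mem_ofPred_eq]
    constructor
    · intro hx
      refine ⟨(T \ S).restrict x, fun v hv => ?_⟩
      by_cases hS : v ∈ S <;> simp [Function.updateFinset, hS, hv, hx]
    · rintro ⟨z, hz⟩ v hv
      rw [hz v (h hv)]
      simp [Function.updateFinset, hv]
  rw [hU, measure_biUnion_finset]
  · rfl
  · intro z _ z' _ hne
    refine Set.disjoint_left.2 fun x hx hx' => hne ?_
    ext v
    have hv := Finset.sdiff_subset v.2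
    have h1 := hx v hv
    have h2 := hx' v hv
    simp only [Function.updateFinset, v.2, dif_pos] at h1 h2
    exact h1.symm.trans h2
  · exact fun z _ => measurableSet_cylEvent _ _

lemma measure_ext_of_cylEvent {d : ℕ} {M : Type} [Fintype M] [MeasurableSpace M]
    [DiscreteMeasurableSpace M] {μ ν : Measure (TdVertex d → M)} [IsFiniteMeasure μ]
    [IsFiniteMeasure ν]
    (h : ∀ (S : Finset (TdVertex d)) (y : TdVertex d → M),
      μ (cylEvent ↑S y) = ν (cylEvent ↑S y)) : μ = ν := by
  rcases isEmpty_or_nonempty (TdVertex d → M) with hE | ⟨⟨y⟩⟩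
  · rw [Measure.eq_zero_of_isEmpty μ, Measure.eq_zero_of_isEmpty ν]
  refine IsProjectiveLimit.unique (P := fun S => ν.map S.restrict) (fun S => ?_) fun S => rfl
  refine Measure.ext_of_singleton fun z : S → M => ?_
  rw [Measure.map_apply (Finset.measurable_restrict S) (measurableSet_singleton z),
    Measure.map_apply (Finset.measurable_restrict S) (measurableSet_singleton z)]
  have hz : (S.restrict : (TdVertex d → M) → S → M) ⁻¹' {z} =
      cylEvent (↑S) (Function.updateFinset y S z) := by
    ext x
    simp only [Set.mem_preimage, Set.mem_singleton_iff, cylEvent, Set.mem_ofPred_eq,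
      Finset.mem_coe, funext_iff, Finset.restrict_def, Subtype.forall]
    exact forall₂_congr fun v hv => by simp [Function.updateFinset, hv]
  rw [hz, h]

lemma exists_measure_cylEvent_eq {d : ℕ} {M : Type} [Fintype M] [Nonempty M] [MeasurableSpace M]
    [DiscreteMeasurableSpace M] {Z : Finset (TdVertex d)} {W : (TdVertex d → M) → ℝ≥0∞}
    (hW : DependsOn W ↑Z) (h1 : ∀ y, fiberSum Z W y = 1) :
    ∃ ν : Measure (TdVertex d → M), IsProbabilityMeasure ν ∧ ∀ y, ν (cylEvent ↑Z y) = W y := by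
  obtain ⟨y₀⟩ : Nonempty (TdVertex d → M) := inferInstance
  refine ⟨∑ z : Z → M, W (Function.updateFinset y₀ Z z) •
    Measure.dirac (Function.updateFinset y₀ Z z), ⟨?_⟩, fun y => ?_⟩
  · simpa [Measure.finsetSum_apply, fiberSum] using h1 y₀
  · rw [Measure.finsetSum_apply, Finset.sum_eq_single (Z.restrict y)]
    · rw [Measure.smul_apply, Measure.dirac_apply' _ (measurableSet_cylEvent _ _),
        Set.indicator_of_mem]
      · simp only [Pi.one_apply, smul_eq_mul, mul_one]
        exact hW fun v hv => by simp [Function.updateFinset, Finset.mem_coe.1 hv]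
      · intro v hv
        simp [Function.updateFinset, Finset.mem_coe.1 hv]
    · intro z _ hz
      rw [Measure.smul_apply, Measure.dirac_apply' _ (measurableSet_cylEvent _ _),
        Set.indicator_of_notMem, smul_zero]
      intro hmem
      refine hz (funext fun v => ?_)
      have := hmem v.1 v.2
      simpa [Function.updateFinset] using this
    · simp

lemma exists_measure_of_eventually_cylEvent {d : ℕ} {M : Type} [Fintype M] [MeasurableSpace M]
    [DiscreteMeasurableSpace M] (ν : ℕ → Measure (TdVertex d → M))
    [∀ n, IsProbabilityMeasure (ν n)] :
    ∃ μ : Measure (TdVertex d → M), IsProbabilityMeasure μ ∧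
      ∀ (S : Finset (TdVertex d)) (y : TdVertex d → M) (c : ℝ≥0∞),
        (∀ᶠ n in atTop, ν n (cylEvent ↑S y) = c) → μ (cylEvent ↑S y) = c := by
  let _ : TopologicalSpace M := ⊥
  have _ : DiscreteTopology M := ⟨rfl⟩
  have _ : BorelSpace M := ⟨by
    rw [borel_eq_top_of_discrete]
    exact eq_top_iff.2 fun s _ => MeasurableSet.of_discrete⟩
  let ν' : ℕ → ProbabilityMeasure (TdVertex d → M) := fun n => ⟨ν n, inferInstance⟩
  have hlim : Tendsto ν' (hyperfilter ℕ : Filter ℕ) (𝓝 ((hyperfilter ℕ).map ν').lim) :=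
    ((hyperfilter ℕ).map ν').le_nhds_lim
  refine ⟨((hyperfilter ℕ).map ν').lim, inferInstance, fun S y c hc => ?_⟩
  have hclopen : IsClopen (cylEvent (↑S) y) := by
    have h : cylEvent (↑S) y = ⋂ v ∈ S, (fun x : TdVertex d → M => x v) ⁻¹' {y v} := by
      ext x; simp [cylEvent]
    rw [h]
    exact isClopen_biInter_finset
      fun v _ => (isClopen_discrete _).preimage (continuous_apply v)
  have ht := ProbabilityMeasure.tendsto_measure_of_null_frontier_of_tendsto' hlim
    (E := cylEvent (↑S) y) (by simp [hclopen.frontier_eq])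
  refine tendsto_nhds_unique ht (tendsto_const_nhds.congr' ?_)
  have hle : (hyperfilter ℕ : Filter ℕ) ≤ atTop := by
    rw [← Nat.cofinite_eq_atTop]; exact hyperfilter_le_cofinite
  exact (hc.filter_mono hle).mono fun n hn => hn.symm

/-! ### The tree metric -/

/-- The distance of two vertices given by the lists of the steps leading to them from the root. -/
def stepDist : List ℕ → List ℕ → ℕ
  | [], b => b.length
  | x :: a, [] => (x :: a).length
  | x :: a, y :: b => if x = y then stepDist a b else (x :: a).length + (y :: b).length

lemma treeDist_eq_stepDist (u w : List ℕ) : treeDist u w = stepDist u.reverse w.reverse := by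
  have key : ∀ a b : List ℕ,
      ((a.zip b).takeWhile (fun p => decide (p.1 = p.2))).length ≤ min a.length b.length ∧
      stepDist a b = (a.length - ((a.zip b).takeWhile (fun p => decide (p.1 = p.2))).length) +
        (b.length - ((a.zip b).takeWhile (fun p => decide (p.1 = p.2))).length) := by
    intro a
    induction a with
    | nil => simp [stepDist]
    | cons x a ih =>
      rintro (_ | ⟨y, b⟩)
      · simp [stepDist]
      · by_cases h : x = y
        · have := ih b
          simp only [stepDist, h, List.zip_cons_cons, List.takeWhile_cons, decide_true, if_true,
            List.length_cons]
          omega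
        · simp [stepDist, h]
  have := (key u.reverse w.reverse).2
  simpa [treeDist] using this.symm

lemma stepDist_comm (a b : List ℕ) : stepDist a b = stepDist b a := by
  induction a generalizing b with
  | nil => cases b <;> rfl
  | cons x a ih =>
    cases b with
    | nil => rfl
    | cons y b =>
      simp only [stepDist, ih b, eq_comm (a := x)]
      split_ifs
      · rfl
      · omega

lemma treeDist_comm (u w : List ℕ) : treeDist u w = treeDist w u := by
  rw [treeDist_eq_stepDist, treeDist_eq_stepDist, stepDist_comm]

lemma treeDist_nil (u : List ℕ) : treeDist u [] = u.length := by
  rw [treeDist_comm, treeDist_eq_stepDist]; simp [stepDist]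

lemma treeDist_self (u : List ℕ) : treeDist u u = 0 := by
  rw [treeDist_eq_stepDist]
  induction u.reverse with
  | nil => rfl
  | cons x a ih => simp [stepDist, ih]

lemma stepDist_append_singleton (a b : List ℕ) (i : ℕ) :
    (b ++ [i] <+: a ∧ stepDist a (b ++ [i]) + 1 = stepDist a b) ∨
      (¬ b ++ [i] <+: a ∧ stepDist a (b ++ [i]) = stepDist a b + 1) := by
  induction b generalizing a with
  | nil =>
    cases a with
    | nil => simp [stepDist]
    | cons x a =>
      by_cases h : x = i
      · left; cases a <;> simp [stepDist, h]
      · right; simp [stepDist, h, Ne.symm h]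
  | cons y b ih =>
    cases a with
    | nil => simp [stepDist]
    | cons x a =>
      by_cases h : x = y
      · simpa [stepDist, h] using ih a
      · right
        simp [stepDist, h, Ne.symm h]
        omega

lemma treeDist_cons_of_suffix {u w : List ℕ} {i : ℕ} (h : i :: w <:+ u) :
    treeDist u (i :: w) + 1 = treeDist u w := by
  simp only [treeDist_eq_stepDist, List.reverse_cons]
  rcases stepDist_append_singleton u.reverse w.reverse i with h' | h'
  · exact h'.2
  · rw [← List.reverse_cons, List.reverse_prefix] at h'
    exact absurd h h'.1

lemma treeDist_cons_of_not_suffix {u w : List ℕ} {i : ℕ} (h : ¬ i :: w <:+ u) :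
    treeDist u (i :: w) = treeDist u w + 1 := by
  simp only [treeDist_eq_stepDist, List.reverse_cons]
  rcases stepDist_append_singleton u.reverse w.reverse i with h' | h'
  · rw [← List.reverse_cons, List.reverse_prefix] at h'
    exact absurd h'.1 h
  · exact h'.2

lemma treeDist_append_of_not_suffix {u w : List ℕ} (h : ¬ w <:+ u) (s : List ℕ) :
    treeDist u (s ++ w) = treeDist u w + s.length := by
  induction s with
  | nil => rfl
  | cons j s ih =>
    rw [List.cons_append, treeDist_cons_of_not_suffix, ih, List.length_cons, add_assoc]
    exact fun h' => h (((List.suffix_append s w).trans (List.suffix_cons j _)).trans h')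

lemma treeDist_append_self (s w : List ℕ) : treeDist w (s ++ w) = s.length := by
  induction s with
  | nil => exact treeDist_self w
  | cons j s ih =>
    rw [List.cons_append, treeDist_cons_of_not_suffix, ih, List.length_cons]
    intro h
    have := h.length_le
    simp at this

lemma exists_append_eq_treeDist (u w : List ℕ) :
    ∃ c s t : List ℕ, u = s ++ c ∧ w = t ++ c ∧ treeDist u w = s.length + t.length := by
  have key : ∀ a b : List ℕ, ∃ c s t : List ℕ,
      a = c ++ s ∧ b = c ++ t ∧ stepDist a b = s.length + t.length := by
    intro a
    induction a with
    | nil => exact fun b => ⟨[], [], b, by simp [stepDist]⟩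
    | cons x a ih =>
      rintro (_ | ⟨y, b⟩)
      · exact ⟨[], x :: a, [], by simp [stepDist]⟩
      · by_cases h : x = y
        · obtain ⟨c, s, t, h1, h2, h3⟩ := ih b
          exact ⟨x :: c, s, t, by simp [h1], by simp [h2, h], by simpa [stepDist, h] using h3⟩
        · exact ⟨[], x :: a, y :: b, by simp [stepDist, h]⟩
  obtain ⟨c, s, t, h1, h2, h3⟩ := key u.reverse w.reverse
  refine ⟨c.reverse, s.reverse, t.reverse, ?_, ?_, ?_⟩
  · rw [← List.reverse_append, ← h1, List.reverse_reverse]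
  · rw [← List.reverse_append, ← h2, List.reverse_reverse]
  · simpa [treeDist_eq_stepDist] using h3

lemma validTd_nil (d : ℕ) : ValidTd d [] := (rootTd d).2

lemma validTd_singleton {d i : ℕ} : ValidTd d [i] ↔ 1 ≤ i ∧ i ≤ d := by simp [ValidTd]

lemma validTd_cons_cons {d i j : ℕ} {l : List ℕ} :
    ValidTd d (i :: j :: l) ↔ (1 ≤ i ∧ i ≤ d - 1) ∧ ValidTd d (j :: l) := by
  simp [ValidTd, List.dropLast_cons_of_ne_nil, List.getLast?_cons_cons, and_assoc]

lemma ValidTd.of_cons {d i : ℕ} {l : List ℕ} (h : ValidTd d (i :: l)) : ValidTd d l := by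
  cases l with
  | nil => exact validTd_nil d
  | cons j l => exact (validTd_cons_cons.1 h).2

lemma ValidTd.of_append {d : ℕ} {s l : List ℕ} (h : ValidTd d (s ++ l)) : ValidTd d l := by
  induction s with
  | nil => exact h
  | cons i s ih => exact ih h.of_cons

lemma ValidTd.le_of_mem {d : ℕ} {l : List ℕ} (h : ValidTd d l) {i : ℕ} (hi : i ∈ l) : i ≤ d := by
  induction l with
  | nil => simp at hi
  | cons j l ih =>
    rcases List.mem_cons.1 hi with rfl | hi'
    · cases l with
      | nil => exact (validTd_singleton.1 h).2
      | cons k l => have := (validTd_cons_cons.1 h).1.2; omega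
    · exact ih h.of_cons hi'

lemma exists_walk_of_eq_append {d : ℕ} {s : List ℕ} {u v : TdVertex d} (h : u.1 = s ++ v.1) :
    ∃ p : (TdGraph d).Walk u v, p.length = s.length := by
  induction s generalizing u with
  | nil =>
    obtain rfl : u = v := Subtype.ext h
    exact ⟨SimpleGraph.Walk.nil, rfl⟩
  | cons i s ih =>
    let u' : TdVertex d := ⟨s ++ v.1, ValidTd.of_cons (i := i) (List.cons_append ▸ h ▸ u.2)⟩
    obtain ⟨p, hp⟩ := ih (u := u') rfl
    have hadj : (TdGraph d).Adj u u' := Or.inr ⟨i, h⟩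
    exact ⟨SimpleGraph.Walk.cons hadj p, by simp [hp]⟩

lemma treeDist_le_walk_length {d : ℕ} (x : List ℕ) {u w : TdVertex d} (p : (TdGraph d).Walk u w) :
    treeDist x u.1 ≤ treeDist x w.1 + p.length := by
  induction p with
  | nil => simp
  | @cons u v w h p ih =>
    have h1 : treeDist x u.1 ≤ treeDist x v.1 + 1 := by
      rcases h with ⟨i, h⟩ | ⟨i, h⟩ <;> rw [h]
      · by_cases hs : i :: u.1 <:+ x
        · rw [← treeDist_cons_of_suffix hs]
        · rw [treeDist_cons_of_not_suffix hs]; omega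
      · by_cases hs : i :: v.1 <:+ x
        · rw [← treeDist_cons_of_suffix hs]; omega
        · rw [treeDist_cons_of_not_suffix hs]
    rw [SimpleGraph.Walk.length_cons]
    omega

lemma exists_walk_length_eq_treeDist {d : ℕ} (u w : TdVertex d) :
    ∃ p : (TdGraph d).Walk u w, p.length = treeDist u.1 w.1 := by
  obtain ⟨c, s, t, hu, hw, h⟩ := exists_append_eq_treeDist u.1 w.1
  let v : TdVertex d := ⟨c, ValidTd.of_append (s := s) (hu ▸ u.2)⟩
  obtain ⟨p, hp⟩ := exists_walk_of_eq_append (v := v) hu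
  obtain ⟨q, hq⟩ := exists_walk_of_eq_append (v := v) hw
  exact ⟨p.append q.reverse, by simp [hp, hq, h]⟩

lemma treeDist_map_le {d : ℕ} (φ : TdGraph d ≃g TdGraph d) (u w : TdVertex d) :
    treeDist (φ u).1 (φ w).1 ≤ treeDist u.1 w.1 := by
  obtain ⟨p, hp⟩ := exists_walk_length_eq_treeDist u w
  have := treeDist_le_walk_length (φ w).1 (p.map φ.toHom)
  rw [SimpleGraph.Walk.length_map, hp] at this
  rw [treeDist_comm]
  refine this.trans ?_
  simp [treeDist_self]

lemma treeDist_map {d : ℕ} (φ : TdGraph d ≃g TdGraph d) (u w : TdVertex d) :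
    treeDist (φ u).1 (φ w).1 = treeDist u.1 w.1 := by
  refine le_antisymm (treeDist_map_le φ u w) ?_
  simpa using treeDist_map_le φ.symm (φ u) (φ w)

lemma mem_sideOf_or {d : ℕ} {u w : TdVertex d} (h : (TdGraph d).Adj u w) (x : TdVertex d) :
    (x ∈ sideOf u w ∧ treeDist x.1 w.1 = treeDist x.1 u.1 + 1) ∨
      (x ∈ sideOf w u ∧ treeDist x.1 u.1 = treeDist x.1 w.1 + 1) := by
  simp only [sideOf, Set.mem_ofPred_eq]
  rcases h with ⟨i, h⟩ | ⟨i, h⟩ <;> rw [h]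
  · by_cases hs : i :: u.1 <:+ x.1
    · have := treeDist_cons_of_suffix hs; omega
    · have := treeDist_cons_of_not_suffix hs; omega
  · by_cases hs : i :: w.1 <:+ x.1
    · have := treeDist_cons_of_suffix hs; omega
    · have := treeDist_cons_of_not_suffix hs; omega

lemma treeDist_eq_of_mem_sideOf {d : ℕ} {u w v x : TdVertex d} (h : (TdGraph d).Adj u w)
    (hv : v ∈ sideOf u w) (hx : x ∈ sideOf w u) :
    treeDist v.1 x.1 = treeDist v.1 u.1 + 1 + treeDist x.1 w.1 := by
  have key : ∀ u w v x : List ℕ, (∃ i, w = i :: u) → treeDist v u < treeDist v w →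
      treeDist x w < treeDist x u → treeDist v x = treeDist v u + 1 + treeDist x w := by
    rintro u w v x ⟨i, rfl⟩ hv hx
    have hv' : ¬ i :: u <:+ v := fun hs => by
      have := treeDist_cons_of_suffix hs; omega
    have hx' : i :: u <:+ x := by
      by_contra hs
      have := treeDist_cons_of_not_suffix hs; omega
    obtain ⟨s, rfl⟩ := hx'
    rw [treeDist_append_of_not_suffix hv', treeDist_cons_of_not_suffix hv',
      treeDist_comm (s ++ _), treeDist_append_self]
  rcases h with h | h
  · exact key _ _ _ _ h hv hx
  · rw [treeDist_comm, key _ _ _ _ h hx hv]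
    omega

lemma disjoint_sideOf {d : ℕ} (u w : TdVertex d) : Disjoint (sideOf u w) (sideOf w u) :=
  Set.disjoint_left.2 fun _ h h' => lt_asymm (α := ℕ) h h'

lemma finite_SrSet (d n : ℕ) : (SrSet d n).Finite := by
  have hfin : ∀ n : ℕ, {l : List ℕ | l.length ≤ n ∧ ∀ i ∈ l, i ≤ d}.Finite := by
    intro n
    induction n with
    | zero =>
      refine (Set.finite_singleton []).subset fun l hl => ?_
      simpa using hl.1
    | succ n ih =>
      refine ((Set.finite_singleton []).union
        (Set.Finite.image2 List.cons (Set.finite_Iic d) ih)).subset ?_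
      rintro (_ | ⟨i, l⟩) ⟨h1, h2⟩
      · simp
      · refine Or.inr ⟨i, h2 i (by simp), l,
          ⟨by simpa using h1, fun j hj => h2 j (by simp [hj])⟩, rfl⟩
  exact Set.Finite.of_finite_image ((hfin n).subset (by
    rintro _ ⟨v, hv, rfl⟩
    exact ⟨hv, fun i hi => v.2.le_of_mem hi⟩)) Subtype.val_injective.injOn

/-! ### Automorphisms of the tree -/

/-- The action on labels of a relabeling of the neighbors of the root. -/
def relabelRoot (σ : ℕ → ℕ) : List ℕ → List ℕ
  | [] => []
  | [i] => [σ i]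
  | j :: k :: l => j :: relabelRoot σ (k :: l)

/-- The action on labels of the automorphism reversing the edge `{o,1}`. -/
def flipEdge : List ℕ → List ℕ
  | [] => [1]
  | [i] => if i = 1 then [] else [i - 1, 1]
  | j :: k :: l => if k = 1 ∧ l = [] then [j + 1] else j :: flipEdge (k :: l)

/-- The automorphism of `T_d` given by an involution preserving adjacency. -/
def isoOfInvolution {d : ℕ} (f : List ℕ → List ℕ) (hf : ∀ l, ValidTd d l → ValidTd d (f l))
    (hff : ∀ l, ValidTd d l → f (f l) = l)
    (hadj : ∀ i l, ValidTd d (i :: l) →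
      (∃ j, f (i :: l) = j :: f l) ∨ (∃ j, f l = j :: f (i :: l))) :
    TdGraph d ≃g TdGraph d where
  toFun v := ⟨f v.1, hf v.1 v.2⟩
  invFun v := ⟨f v.1, hf v.1 v.2⟩
  left_inv v := Subtype.ext (hff v.1 v.2)
  right_inv v := Subtype.ext (hff v.1 v.2)
  map_rel_iff' := by
    have key : ∀ l l', ValidTd d l → ValidTd d l' → ((∃ i, l' = i :: l) ∨ (∃ i, l = i :: l')) →
        (∃ i, f l' = i :: f l) ∨ (∃ i, f l = i :: f l') := by
      rintro l l' hl hl' (⟨i, rfl⟩ | ⟨i, rfl⟩)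
      · exact hadj i l hl'
      · exact (hadj i l' hl).symm
    intro v w
    refine ⟨fun h => ?_, key v.1 w.1 v.2 w.2⟩
    have := key _ _ (hf v.1 v.2) (hf w.1 w.2) h
    rwa [hff _ v.2, hff _ w.2] at this

lemma exists_iso_relabelRoot {d : ℕ} {k : ℕ} (hk : 1 ≤ k ∧ k ≤ d) :
    ∃ φ : TdGraph d ≃g TdGraph d, (φ (rootTd d)).1 = [] ∧ ∀ v : TdVertex d, v.1 = [k] →
      (φ v).1 = [1] := by
  have hne : ∀ i l, relabelRoot (Equiv.swap k 1) (i :: l) ≠ [] := by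
    rintro i (_ | ⟨j, l⟩) <;> simp [relabelRoot]
  refine ⟨isoOfInvolution (relabelRoot (Equiv.swap k 1)) ?_ ?_ ?_, rfl, ?_⟩
  · intro l
    induction l with
    | nil => exact id
    | cons i l ih =>
      cases l with
      | nil =>
        simp only [relabelRoot, validTd_singleton]
        intro h
        rw [Equiv.swap_apply_def]
        split_ifs <;> omega
      | cons j l =>
        intro h
        rw [relabelRoot]
        have h1 := validTd_cons_cons.1 h
        have h2 := ih h1.2
        obtain ⟨a, t, hat⟩ := List.exists_cons_of_ne_nil (hne j l)
        rw [hat] at h2 ⊢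
        exact validTd_cons_cons.2 ⟨h1.1, h2⟩
  · intro l hl
    induction l with
    | nil => rfl
    | cons i l ih =>
      cases l with
      | nil => simp [relabelRoot]
      | cons j l =>
        have h2 := ih hl.of_cons
        obtain ⟨a, t, hat⟩ := List.exists_cons_of_ne_nil (hne j l)
        rw [relabelRoot]
        rw [hat] at h2 ⊢
        rw [relabelRoot, h2]
  · rintro i (_ | ⟨j, l⟩) _
    · exact Or.inl ⟨_, rfl⟩
    · exact Or.inl ⟨i, rfl⟩
  · intro v h
    change relabelRoot (Equiv.swap k 1) v.1 = [1]
    simp [h, relabelRoot]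

lemma flipEdge_cons_cons_of_ne {j k : ℕ} {l : List ℕ} (h : ¬ (k = 1 ∧ l = [])) :
    flipEdge (j :: k :: l) = j :: flipEdge (k :: l) := by
  rw [flipEdge, if_neg h]

lemma flipEdge_ne_nil {k : ℕ} {l : List ℕ} (h : ¬ (k = 1 ∧ l = [])) :
    flipEdge (k :: l) ≠ [] := by
  cases l with
  | nil =>
    have : k ≠ 1 := by simpa using h
    simp [flipEdge, this]
  | cons j l =>
    rw [flipEdge]
    split_ifs <;> simp

lemma exists_iso_flipEdge {d : ℕ} (hd : 3 ≤ d) :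
    ∃ φ : TdGraph d ≃g TdGraph d, (φ (rootTd d)).1 = [1] ∧ ∀ v : TdVertex d, v.1 = [1] →
      (φ v).1 = [] := by
  have hinv : ∀ l, ValidTd d l → flipEdge (flipEdge l) = l := by
    intro l
    induction l with
    | nil => simp [flipEdge]
    | cons i l ih =>
      cases l with
      | nil =>
        intro h
        have := validTd_singleton.1 h
        by_cases hi : i = 1
        · simp [flipEdge, hi]
        · simp [flipEdge, hi]
          omega
      | cons k l =>
        intro h
        have h1 := validTd_cons_cons.1 h
        by_cases hk : k = 1 ∧ l = []
        · have : i ≠ 0 := by omega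
          simp [flipEdge, hk, this]
        · rw [flipEdge_cons_cons_of_ne hk]
          have h2 := ih h1.2
          obtain ⟨a, t, hat⟩ := List.exists_cons_of_ne_nil (flipEdge_ne_nil hk)
          rw [hat] at h2 ⊢
          rw [flipEdge_cons_cons_of_ne, h2]
          rintro ⟨rfl, rfl⟩
          simp [flipEdge] at h2
  refine ⟨isoOfInvolution flipEdge ?_ hinv ?_, rfl, ?_⟩
  · intro l
    induction l with
    | nil => intro _; rw [flipEdge, validTd_singleton]; omega
    | cons i l ih =>
      cases l with
      | nil =>
        intro h
        have := validTd_singleton.1 h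
        rw [flipEdge]
        split_ifs with hi
        · exact validTd_nil d
        · rw [validTd_cons_cons, validTd_singleton]
          omega
      | cons k l =>
        intro h
        have h1 := validTd_cons_cons.1 h
        by_cases hk : k = 1 ∧ l = []
        · rw [flipEdge, if_pos hk, validTd_singleton]
          omega
        · rw [flipEdge_cons_cons_of_ne hk]
          have h2 := ih h1.2
          obtain ⟨a, t, hat⟩ := List.exists_cons_of_ne_nil (flipEdge_ne_nil hk)
          rw [hat] at h2 ⊢
          exact validTd_cons_cons.2 ⟨h1.1, h2⟩
  · rintro i (_ | ⟨k, l⟩) _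
    · by_cases hi : i = 1
      · exact Or.inr ⟨1, by simp [flipEdge, hi]⟩
      · exact Or.inl ⟨i - 1, by simp [flipEdge, hi]⟩
    · by_cases hk : k = 1 ∧ l = []
      · exact Or.inl ⟨i + 1, by simp [flipEdge, hk]⟩
      · exact Or.inl ⟨i, flipEdge_cons_cons_of_ne hk⟩
  · intro v h
    change flipEdge v.1 = []
    simp [h, flipEdge]

lemma adj_rootTd_iff {d : ℕ} {w : TdVertex d} :
    (TdGraph d).Adj (rootTd d) w ↔ ∃ k, w.1 = [k] := by
  simp [TdGraph, rootTd]

lemma node1_val {d : ℕ} (hd : 1 ≤ d) : (node1 d).1 = [1] := by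
  simp [node1, hd]

lemma exists_iso_of_map_eq_root {d : ℕ} (hd : 1 ≤ d) {u w : TdVertex d}
    (h : (TdGraph d).Adj u w)
    (hu : ∃ φ : TdGraph d ≃g TdGraph d, φ u = rootTd d) :
    ∃ φ : TdGraph d ≃g TdGraph d, φ u = rootTd d ∧ φ w = node1 d := by
  obtain ⟨φ, hφ⟩ := hu
  have h' : (TdGraph d).Adj (φ u) (φ w) := φ.map_adj_iff.2 h
  rw [hφ, adj_rootTd_iff] at h'
  obtain ⟨k, hk⟩ := h'
  obtain ⟨ψ, h1, h2⟩ := exists_iso_relabelRoot (validTd_singleton.1 (hk ▸ (φ w).2))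
  refine ⟨φ.trans ψ, ?_, ?_⟩
  · rw [RelIso.trans_apply, hφ]
    exact Subtype.ext h1
  · rw [RelIso.trans_apply]
    exact Subtype.ext ((h2 _ hk).trans (node1_val hd).symm)

lemma exists_iso_map_eq_root {d : ℕ} (hd : 3 ≤ d) (v : TdVertex d) :
    ∃ φ : TdGraph d ≃g TdGraph d, φ v = rootTd d := by
  induction hv : v.1 generalizing v with
  | nil => exact ⟨RelIso.refl _, Subtype.ext hv⟩
  | cons i l ih =>
    let u : TdVertex d := ⟨l, ValidTd.of_cons (i := i) (hv ▸ v.2)⟩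
    obtain ⟨φ, -, hφ⟩ := exists_iso_of_map_eq_root (u := u) (w := v) (by omega)
      (Or.inl ⟨i, hv⟩) (ih u rfl)
    obtain ⟨ψ, -, hψ⟩ := exists_iso_flipEdge hd
    refine ⟨φ.trans ψ, ?_⟩
    rw [RelIso.trans_apply, hφ]
    exact Subtype.ext (hψ _ (node1_val (by omega)))

lemma exists_iso_map_arc {d : ℕ} (hd : 3 ≤ d) {u w : TdVertex d} (h : (TdGraph d).Adj u w) :
    ∃ φ : TdGraph d ≃g TdGraph d, φ u = rootTd d ∧ φ w = node1 d :=
  exists_iso_of_map_eq_root (by omega) h (exists_iso_map_eq_root hd u)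

/-! ### Balls and root-closed sets of vertices -/

/-- The ball of radius `r` around `v`. -/
def ballTd {d : ℕ} (r : ℕ) (v : TdVertex d) : Finset (TdVertex d) :=
  Set.Finite.toFinset (s := {x : TdVertex d | treeDist x.1 v.1 ≤ r}) <|
    (finite_SrSet d (r + v.1.length)).subset fun x hx => by
      have h := treeDist_le_walk_length x.1 (exists_walk_length_eq_treeDist (rootTd d) v).choose
      rw [(exists_walk_length_eq_treeDist (rootTd d) v).choose_spec, treeDist_comm (rootTd d).1 v.1,
        show (rootTd d).1 = [] from rfl, treeDist_nil, treeDist_nil] at h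
      simp only [SrSet, Set.mem_ofPred_eq] at hx ⊢
      omega

lemma mem_ballTd {d r : ℕ} {v x : TdVertex d} : x ∈ ballTd r v ↔ treeDist x.1 v.1 ≤ r := by
  simp [ballTd]

/-- The set of vertices at distance at most `r - 1` from the edge `{u,w}`, as a finite set. -/
def edgeBallTd {d : ℕ} (r : ℕ) (u w : TdVertex d) : Finset (TdVertex d) :=
  {x ∈ ballTd r u ∪ ballTd r w | x ∈ edgeBall r u w}

lemma coe_edgeBallTd {d : ℕ} (r : ℕ) (u w : TdVertex d) :
    (↑(edgeBallTd r u w) : Set (TdVertex d)) = edgeBall r u w := by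
  ext x
  rw [Finset.mem_coe, edgeBallTd, Finset.mem_filter, Finset.mem_union, mem_ballTd, mem_ballTd]
  change (_ ∧ (_ ∨ _)) ↔ (_ ∨ _)
  omega

lemma mem_edgeBallTd {d r : ℕ} {u w x : TdVertex d} :
    x ∈ edgeBallTd r u w ↔ treeDist x.1 u.1 + 1 ≤ r ∨ treeDist x.1 w.1 + 1 ≤ r := by
  rw [← Finset.mem_coe, coe_edgeBallTd]; rfl

lemma edgeBallTd_comm {d r : ℕ} (u w : TdVertex d) : edgeBallTd r u w = edgeBallTd r w u := by
  ext x
  rw [mem_edgeBallTd, mem_edgeBallTd, or_comm]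

lemma edgeBallTd_subset_left {d r : ℕ} {u w : TdVertex d} (h : (TdGraph d).Adj u w) :
    edgeBallTd r u w ⊆ ballTd r u := by
  intro x hx
  rw [mem_edgeBallTd] at hx
  rw [mem_ballTd]
  have := mem_sideOf_or h x
  omega

lemma edgeBallTd_subset_right {d r : ℕ} {u w : TdVertex d} (h : (TdGraph d).Adj u w) :
    edgeBallTd r u w ⊆ ballTd r w :=
  edgeBallTd_comm (r := r) u w ▸ edgeBallTd_subset_left h.symm

lemma mem_edgeBallTd_of_mem_ballTd {d r : ℕ} {u w v x : TdVertex d} (h : (TdGraph d).Adj u w)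
    (hv : v ∈ sideOf u w) (hx : x ∈ sideOf w u) (hxv : x ∈ ballTd r v) :
    x ∈ edgeBallTd r u w := by
  have := treeDist_eq_of_mem_sideOf h hv hx
  rw [treeDist_comm] at this
  rw [mem_ballTd] at hxv
  rw [mem_edgeBallTd]
  omega

lemma left_mem_sideOf {d : ℕ} {u w : TdVertex d} (h : (TdGraph d).Adj u w) : u ∈ sideOf u w := by
  have := mem_sideOf_or h u
  rw [treeDist_self] at this
  rcases this with h | h
  · exact h.1
  · omega

/-- The parent of a vertex (the root itself for the root). -/
def parentTd {d : ℕ} (v : TdVertex d) : TdVertex d :=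
  ⟨v.1.tail, by
    obtain ⟨_ | ⟨i, l⟩, hl⟩ := v
    · exact hl
    · exact hl.of_cons⟩

/-- A set of vertices containing the root and closed under taking parents. -/
def RootClosed {d : ℕ} (A : Finset (TdVertex d)) : Prop :=
  rootTd d ∈ A ∧ ∀ v ∈ A, parentTd v ∈ A

lemma rootClosed_singleton (d : ℕ) : RootClosed {rootTd d} := by
  refine ⟨by simp, fun v hv => ?_⟩
  rw [Finset.mem_singleton] at hv ⊢
  subst hv
  rfl

lemma mem_toFinset_SrSet {d n : ℕ} {v : TdVertex d} :
    v ∈ (finite_SrSet d n).toFinset ↔ v.1.length ≤ n :=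
  Set.Finite.mem_toFinset _

lemma rootClosed_SrSet (d n : ℕ) : RootClosed (finite_SrSet d n).toFinset := by
  refine ⟨mem_toFinset_SrSet.2 (Nat.zero_le n), fun v hv => ?_⟩
  rw [mem_toFinset_SrSet] at hv ⊢
  change v.1.tail.length ≤ n
  rw [List.length_tail]
  omega

lemma exists_eq_cons_parentTd {d : ℕ} {w : TdVertex d} (hw : w ≠ rootTd d) :
    ∃ i, w.1 = i :: (parentTd w).1 := by
  obtain ⟨_ | ⟨i, l⟩, hl⟩ := w
  · exact absurd rfl hw
  · exact ⟨i, rfl⟩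

lemma adj_parentTd {d : ℕ} {w : TdVertex d} (hw : w ≠ rootTd d) :
    (TdGraph d).Adj (parentTd w) w :=
  Or.inl (exists_eq_cons_parentTd hw)

lemma RootClosed.subset_sideOf {d : ℕ} {A : Finset (TdVertex d)} (hA : RootClosed A)
    {w : TdVertex d} (hw : w ∉ A) : ↑A ⊆ sideOf (parentTd w) w := by
  have hsuff : ∀ (s : List ℕ) (v : TdVertex d), v.1 = s ++ w.1 → v ∉ A := by
    intro s
    induction s with
    | nil =>
      intro v hv
      rwa [show v = w from Subtype.ext hv]
    | cons j s ih => exact fun v hv hvA => ih (parentTd v) (by simp [parentTd, hv]) (hA.2 v hvA)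
  intro v hv
  obtain ⟨i, hi⟩ := exists_eq_cons_parentTd (w := w) fun h => hw (h ▸ hA.1)
  have hns : ¬ i :: (parentTd w).1 <:+ v.1 := by
    rw [← hi]
    rintro ⟨s, hs⟩
    exact hsuff s v hs.symm hv
  change treeDist v.1 (parentTd w).1 < treeDist v.1 w.1
  rw [hi, treeDist_cons_of_not_suffix hns]
  omega

lemma RootClosed.induction_from {d : ℕ} {A₀ : Finset (TdVertex d)} {P : Finset (TdVertex d) → Prop}
    (base : P A₀)
    (step : ∀ A w, A₀ ⊆ A → RootClosed A → w ∉ A → parentTd w ∈ A → P A → P (insert w A))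
    (A : Finset (TdVertex d)) (hA : RootClosed A) (h : A₀ ⊆ A) (h₀ : RootClosed A₀) : P A := by
  induction hn : (A \ A₀).card generalizing A with
  | zero =>
    rw [Finset.card_eq_zero, Finset.sdiff_eq_empty_iff_subset] at hn
    rwa [← h.antisymm hn]
  | succ n ih =>
    obtain ⟨w, hw, hmax⟩ := Finset.exists_max_image (A \ A₀) (fun v => v.1.length)
      (Finset.card_pos.1 (by omega))
    rw [Finset.mem_sdiff] at hw
    have hw0 : w ≠ rootTd d := fun h => hw.2 (h ▸ h₀.1)
    obtain ⟨i, hi⟩ := exists_eq_cons_parentTd hw0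
    have hlen := congrArg List.length hi
    have hcl : RootClosed (A.erase w) := by
      refine ⟨Finset.mem_erase.2 ⟨hw0.symm, hA.1⟩, fun v hv => ?_⟩
      rw [Finset.mem_erase] at hv
      refine Finset.mem_erase.2 ⟨fun hvw => ?_, hA.2 v hv.2⟩
      by_cases hv0 : v ∈ A₀
      · exact hw.2 (hvw ▸ h₀.2 v hv0)
      · have h1 := hmax v (Finset.mem_sdiff.2 ⟨hv.2, hv0⟩)
        have h2 := congrArg (fun v : TdVertex d => v.1.length) hvw
        simp only [parentTd, List.length_tail, List.length_cons] at h1 h2 hlen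
        omega
    have hsub : A₀ ⊆ A.erase w := fun v hv =>
      Finset.mem_erase.2 ⟨fun h => hw.2 (h ▸ hv), h hv⟩
    have hpar : parentTd w ∈ A.erase w := by
      refine Finset.mem_erase.2 ⟨fun h => ?_, hA.2 w hw.1⟩
      rw [h] at hlen
      simp at hlen
    rw [← Finset.insert_erase hw.1]
    refine step _ w hsub hcl (Finset.notMem_erase w A) hpar (ih _ hcl hsub ?_)
    rw [Finset.erase_sdiff_comm, Finset.card_erase_of_mem (Finset.mem_sdiff.2 hw), hn]
    rfl

/-- The set of vertices at distance at most `r` from `A`. -/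
def regionTd {d : ℕ} (r : ℕ) (A : Finset (TdVertex d)) : Finset (TdVertex d) :=
  A.biUnion (ballTd r)

lemma ballTd_subset_regionTd {d r : ℕ} {A : Finset (TdVertex d)} {v : TdVertex d} (hv : v ∈ A) :
    ballTd r v ⊆ regionTd r A :=
  Finset.subset_biUnion_of_mem (ballTd r) hv

lemma exists_subset_SrSet {d : ℕ} (S : Finset (TdVertex d)) :
    ∃ n, S ⊆ (finite_SrSet d n).toFinset := by
  refine ⟨S.sup fun v => v.1.length, fun v hv => ?_⟩
  rw [Set.Finite.mem_toFinset]
  exact Finset.le_sup (f := fun v : TdVertex d => v.1.length) hv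

lemma subset_regionTd {d : ℕ} (r : ℕ) (A : Finset (TdVertex d)) : A ⊆ regionTd r A :=
  fun v hv => ballTd_subset_regionTd hv (mem_ballTd.2 (by simp [treeDist_self]))

lemma mem_sideOf_or_mem_edgeBallTd {d r : ℕ} {u w v x : TdVertex d} (h : (TdGraph d).Adj u w)
    (hv : v ∈ sideOf u w) (hx : x ∈ ballTd r v) : x ∈ sideOf u w ∨ x ∈ edgeBallTd r u w := by
  rcases mem_sideOf_or h x with hs | hs
  · exact Or.inl hs.1
  · exact Or.inr (mem_edgeBallTd_of_mem_ballTd h hv hs.1 hx)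

lemma RootClosed.ballTd_inter_regionTd_subset {d r : ℕ} {A : Finset (TdVertex d)}
    (hA : RootClosed A) {w : TdVertex d} (hw : w ∉ A) :
    ballTd r w ∩ regionTd r A ⊆ edgeBallTd r (parentTd w) w := by
  intro x hx
  have hadj := adj_parentTd (w := w) fun h => hw (h ▸ hA.1)
  rw [Finset.mem_inter, regionTd, Finset.mem_biUnion] at hx
  obtain ⟨hxw, v, hv, hxv⟩ := hx
  have h1 := mem_sideOf_or_mem_edgeBallTd hadj (hA.subset_sideOf hw hv) hxv
  have h2 := mem_sideOf_or_mem_edgeBallTd hadj.symm (left_mem_sideOf hadj.symm) hxw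
  rw [edgeBallTd_comm] at h2
  rcases h1 with h1 | h1
  · rcases h2 with h2 | h2
    · exact absurd h2 (Set.disjoint_left.1 (disjoint_sideOf _ _) h1)
    · exact h2
  · exact h1

lemma RootClosed.ballTd_sdiff_regionTd {d r : ℕ} {A : Finset (TdVertex d)}
    (hA : RootClosed A) {w : TdVertex d} (hw : w ∉ A) (hpar : parentTd w ∈ A) :
    ballTd r w \ regionTd r A = ballTd r w \ edgeBallTd r (parentTd w) w := by
  have hadj := adj_parentTd (w := w) fun h => hw (h ▸ hA.1)
  have h1 := hA.ballTd_inter_regionTd_subset (r := r) hw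
  have h2 := (edgeBallTd_subset_left (r := r) hadj).trans (ballTd_subset_regionTd hpar)
  ext x
  simp only [Finset.mem_sdiff]
  exact and_congr_right fun hx => not_congr
    ⟨fun h => h1 (Finset.mem_inter.2 ⟨hx, h⟩), fun h => h2 h⟩

/-! ### Markov processes with prescribed marginals on balls -/

section MarkovWeight

variable {d r : ℕ} {M : Type} [MeasurableSpace M] {P : TdVertex d → Measure (TdVertex d → M)}

/-- The measures `P v` give the same marginal to the neighborhood of an edge, when `v` ranges
over the endpoints of this edge. -/
def EdgeCompatible {d : ℕ} {M : Type} [MeasurableSpace M] (r : ℕ)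
    (P : TdVertex d → Measure (TdVertex d → M)) : Prop :=
  ∀ u w, (TdGraph d).Adj u w → ∀ y,
    P u (cylEvent ↑(edgeBallTd r u w) y) = P w (cylEvent ↑(edgeBallTd r u w) y)

/-- The conditional probability, under `P v`, of the coloring `y` on the ball around `v` given
the coloring on the neighborhood of the edge from `v` to its parent. -/
def vertexWeight {d : ℕ} {M : Type} [MeasurableSpace M] (r : ℕ)
    (P : TdVertex d → Measure (TdVertex d → M)) (v : TdVertex d) (y : TdVertex d → M) : ℝ≥0∞ :=
  if v = rootTd d then P v (cylEvent ↑(ballTd r v) y)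
  else P v (cylEvent ↑(ballTd r v) y) / P v (cylEvent ↑(edgeBallTd r (parentTd v) v) y)

/-- The product over the vertices of `A` of the conditional probabilities `vertexWeight`. -/
def markovWeight {d : ℕ} {M : Type} [MeasurableSpace M] (r : ℕ)
    (P : TdVertex d → Measure (TdVertex d → M)) (A : Finset (TdVertex d))
    (y : TdVertex d → M) : ℝ≥0∞ :=
  ∏ v ∈ A, vertexWeight r P v y

/-- The process `μ` has the marginals given by `markovWeight`. -/
def HasMarkovWeight {d : ℕ} {M : Type} [MeasurableSpace M] (r : ℕ)
    (P : TdVertex d → Measure (TdVertex d → M)) (μ : Measure (TdVertex d → M)) : Prop :=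
  ∀ A, RootClosed A → ∀ y, μ (cylEvent ↑(regionTd r A) y) = markovWeight r P A y

lemma dependsOn_vertexWeight (v : TdVertex d) :
    DependsOn (vertexWeight r P v) ↑(ballTd r v) := by
  intro y y' h
  unfold vertexWeight
  split_ifs with hv
  · exact dependsOn_cylEvent _ _ h
  · exact congrArg₂ (· / ·) (dependsOn_cylEvent (P v) _ h) (dependsOn_cylEvent (P v) _ fun x hx =>
      h x (edgeBallTd_subset_right (adj_parentTd hv) hx))

lemma dependsOn_prod_vertexWeight {B : Finset (TdVertex d)} {S : Set (TdVertex d)}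
    (h : ∀ v ∈ B, ↑(ballTd r v) ⊆ S) :
    DependsOn (fun y => ∏ v ∈ B, vertexWeight r P v y) S :=
  fun _ _ hy => Finset.prod_congr rfl fun v hv =>
    dependsOn_vertexWeight v fun x hx => hy x (h v hv hx)

lemma dependsOn_markovWeight (A : Finset (TdVertex d)) :
    DependsOn (markovWeight r P A) ↑(regionTd r A) :=
  dependsOn_prod_vertexWeight fun _ hv => ballTd_subset_regionTd hv

lemma markovWeight_insert {A : Finset (TdVertex d)} {w : TdVertex d} (hw : w ∉ A)
    (y : TdVertex d → M) :
    markovWeight r P (insert w A) y = markovWeight r P A y * vertexWeight r P w y := by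
  rw [markovWeight, Finset.prod_insert hw, mul_comm, markovWeight]

lemma regionTd_insert (A : Finset (TdVertex d)) (w : TdVertex d) :
    regionTd r (insert w A) = ballTd r w ∪ regionTd r A :=
  Finset.biUnion_insert

lemma regionTd_singleton (w : TdVertex d) : regionTd r {w} = ballTd r w :=
  Finset.singleton_biUnion

lemma regionTd_mono {A B : Finset (TdVertex d)} (h : A ⊆ B) : regionTd r A ⊆ regionTd r B :=
  Finset.biUnion_subset_biUnion_of_subset_left _ h

lemma markovWeight_eq_zero {A : Finset (TdVertex d)} {u w : TdVertex d}
    (h : (TdGraph d).Adj u w) (hu : u ∈ A) {y : TdVertex d → M}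
    (h0 : P u (cylEvent ↑(edgeBallTd r u w) y) = 0) : markovWeight r P A y = 0 := by
  refine Finset.prod_eq_zero hu ?_
  have : P u (cylEvent ↑(ballTd r u) y) = 0 :=
    measure_mono_null (cylEvent_anti (edgeBallTd_subset_left h) y) h0
  simp [vertexWeight, this]

variable [Fintype M] [DiscreteMeasurableSpace M]

lemma fiberSum_vertexWeight {w : TdVertex d} (hw : w ≠ rootTd d) (y : TdVertex d → M) :
    fiberSum (ballTd r w \ edgeBallTd r (parentTd w) w) (vertexWeight r P w) y =
      P w (cylEvent ↑(edgeBallTd r (parentTd w) w) y) /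
        P w (cylEvent ↑(edgeBallTd r (parentTd w) w) y) := by
  have h : vertexWeight r P w = fun y => (P w (cylEvent ↑(edgeBallTd r (parentTd w) w) y))⁻¹ *
      P w (cylEvent ↑(ballTd r w) y) := by
    ext y
    rw [vertexWeight, if_neg hw, mul_comm, div_eq_mul_inv]
  have hd : DependsOn (fun y => (P w (cylEvent ↑(edgeBallTd r (parentTd w) w) y))⁻¹)
      (↑(edgeBallTd r (parentTd w) w)) :=
    fun _ _ hy => congrArg _ (dependsOn_cylEvent (P w) _ hy)
  rw [h, fiberSum_mul_left (Finset.disjoint_coe.2 Finset.disjoint_sdiff) hd,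
    fiberSum_cylEvent _ (edgeBallTd_subset_right (adj_parentTd hw)), mul_comm, div_eq_mul_inv]

lemma fiberSum_markovWeight_insert [∀ v, IsProbabilityMeasure (P v)] (hP : EdgeCompatible r P)
    {A : Finset (TdVertex d)} (hA : RootClosed A) {w : TdVertex d} (hw : w ∉ A)
    (hpar : parentTd w ∈ A) :
    fiberSum (regionTd r (insert w A) \ regionTd r A) (markovWeight r P (insert w A)) =
      markovWeight r P A := by
  have hw0 : w ≠ rootTd d := fun h => hw (h ▸ hA.1)
  have hadj := adj_parentTd hw0
  ext y
  rw [funext (markovWeight_insert hw), fiberSum_mul_left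
    (Finset.disjoint_coe.2 Finset.disjoint_sdiff) (dependsOn_markovWeight A), regionTd_insert,
    Finset.union_sdiff_right, hA.ballTd_sdiff_regionTd hw hpar, fiberSum_vertexWeight hw0]
  by_cases h0 : P w (cylEvent ↑(edgeBallTd r (parentTd w) w) y) = 0
  · rw [markovWeight_eq_zero hadj hpar ((hP _ _ hadj y).trans h0), zero_mul]
  · rw [ENNReal.div_self h0 (measure_ne_top _ _), mul_one]

lemma fiberSum_markovWeight [∀ v, IsProbabilityMeasure (P v)] (hP : EdgeCompatible r P)
    {A B : Finset (TdVertex d)} (hA : RootClosed A) (hB : RootClosed B) (hAB : A ⊆ B) :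
    fiberSum (regionTd r B \ regionTd r A) (markovWeight r P B) = markovWeight r P A := by
  refine RootClosed.induction_from
    (P := fun B => fiberSum (regionTd r B \ regionTd r A) (markovWeight r P B) =
      markovWeight r P A) ?_ (fun B w hAB hB hw hpar ih => ?_) B hB hAB hA
  · ext y
    rw [Finset.sdiff_self, fiberSum_empty]
  · have hsub := regionTd_mono (r := r) (Finset.subset_insert w B)
    have hsplit : regionTd r (insert w B) \ regionTd r A =
        (regionTd r B \ regionTd r A) ∪ (regionTd r (insert w B) \ regionTd r B) := by
      rw [Finset.union_comm]
      exact (Finset.sdiff_union_sdiff_cancel hsub (regionTd_mono hAB)).symm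
    ext y
    rw [hsplit, fiberSum_union, fiberSum_markovWeight_insert hP hB hw hpar, ih]
    exact Finset.disjoint_sdiff.mono_left Finset.sdiff_subset

lemma fiberSum_regionTd_markovWeight [∀ v, IsProbabilityMeasure (P v)] (hP : EdgeCompatible r P)
    {A : Finset (TdVertex d)} (hA : RootClosed A) (y : TdVertex d → M) :
    fiberSum (regionTd r A) (markovWeight r P A) y = 1 := by
  have hsub : {rootTd d} ⊆ A := Finset.singleton_subset_iff.2 hA.1
  rw [← Finset.union_sdiff_of_subset (regionTd_mono (r := r) hsub),
    fiberSum_union Finset.disjoint_sdiff, fiberSum_markovWeight hP (rootClosed_singleton d) hA hsub]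
  have h : markovWeight r P {rootTd d} =
      fun y => P (rootTd d) (cylEvent ↑(ballTd r (rootTd d)) y) := by
    ext y
    simp [markovWeight, vertexWeight]
  have h2 := fiberSum_cylEvent (P (rootTd d)) (Finset.empty_subset (ballTd r (rootTd d))) y
  rw [Finset.sdiff_empty] at h2
  rw [h, regionTd_singleton, h2]
  simp [cylEvent]

lemma exists_hasMarkovWeight [Nonempty M] [∀ v, IsProbabilityMeasure (P v)]
    (hP : EdgeCompatible r P) :
    ∃ μ : Measure (TdVertex d → M), IsProbabilityMeasure μ ∧ HasMarkovWeight r P μ := by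
  choose ν hν hW using fun n => exists_measure_cylEvent_eq
    (dependsOn_markovWeight (r := r) (P := P) (finite_SrSet d n).toFinset)
    (fiberSum_regionTd_markovWeight hP (rootClosed_SrSet d n))
  obtain ⟨μ, hμ, h⟩ := exists_measure_of_eventually_cylEvent ν
  refine ⟨μ, hμ, fun A hA y => h _ _ _ ?_⟩
  obtain ⟨n₀, hn₀⟩ := exists_subset_SrSet A
  filter_upwards [eventually_ge_atTop n₀] with n hn
  have hAn : A ⊆ (finite_SrSet d n).toFinset := fun v hv =>
    mem_toFinset_SrSet.2 ((mem_toFinset_SrSet.1 (hn₀ hv)).trans hn)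
  rw [← fiberSum_cylEvent (ν n) (regionTd_mono hAn), funext (hW n),
    fiberSum_markovWeight hP hA (rootClosed_SrSet d n) hAn]

lemma HasMarkovWeight.measure_eq {μ ν : Measure (TdVertex d → M)} [IsFiniteMeasure μ]
    [IsFiniteMeasure ν] (hμ : HasMarkovWeight r P μ) (hν : HasMarkovWeight r P ν) : μ = ν := by
  refine measure_ext_of_cylEvent fun S y => ?_
  obtain ⟨n, hn⟩ := exists_subset_SrSet S
  have hS := hn.trans (subset_regionTd r _)
  rw [← fiberSum_cylEvent μ hS, ← fiberSum_cylEvent ν hS, funext (hμ _ (rootClosed_SrSet d n)),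
    funext (hν _ (rootClosed_SrSet d n))]

lemma HasMarkovWeight.measure_cylEvent_ballTd_eq_mul {μ : Measure (TdVertex d → M)}
    (hμ : HasMarkovWeight r P μ) {A : Finset (TdVertex d)} (hA : RootClosed A) {w : TdVertex d}
    (hw : w ∉ A) (hpar : parentTd w ∈ A) (y : TdVertex d → M) :
    μ (cylEvent ↑(ballTd r w) y) =
      vertexWeight r P w y * μ (cylEvent ↑(edgeBallTd r (parentTd w) w) y) := by
  have hadj := adj_parentTd (w := w) fun h => hw (h ▸ hA.1)
  have hE := (edgeBallTd_subset_left (r := r) hadj).trans (ballTd_subset_regionTd hpar)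
  have hcl : RootClosed (insert w A) := by
    refine ⟨Finset.mem_insert_of_mem hA.1, fun v hv => Finset.mem_insert_of_mem ?_⟩
    rcases Finset.mem_insert.1 hv with rfl | hv
    · exact hpar
    · exact hA.2 v hv
  have hdiff : regionTd r (insert w A) \ ballTd r w =
      regionTd r A \ edgeBallTd r (parentTd w) w := by
    have h1 := hA.ballTd_inter_regionTd_subset (r := r) hw
    have h2 := edgeBallTd_subset_right (r := r) hadj
    ext x
    simp only [regionTd_insert, Finset.mem_sdiff, Finset.mem_union]
    constructor
    · rintro ⟨h | h, hx⟩
      · exact absurd h hx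
      · exact ⟨h, fun h' => hx (h2 h')⟩
    · rintro ⟨h, hx⟩
      exact ⟨Or.inr h, fun h' => hx (h1 (Finset.mem_inter.2 ⟨h', h⟩))⟩
  have hdisj : Disjoint (↑(ballTd r w) : Set (TdVertex d))
      ↑(regionTd r A \ edgeBallTd r (parentTd w) w) := by
    rw [← hdiff]
    exact Finset.disjoint_coe.2 Finset.disjoint_sdiff
  rw [← fiberSum_cylEvent μ (ballTd_subset_regionTd (r := r) (Finset.mem_insert_self w A)), hdiff,
    ← fiberSum_cylEvent μ hE, funext (hμ _ hcl), funext (hμ _ hA),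
    ← fiberSum_mul_left hdisj (dependsOn_vertexWeight w)]
  exact congrArg (fun f => fiberSum _ f y) (funext fun y => by
    rw [markovWeight_insert hw, mul_comm])

lemma HasMarkovWeight.measure_cylEvent_ballTd {μ : Measure (TdVertex d → M)}
    [∀ v, IsProbabilityMeasure (P v)] (hP : EdgeCompatible r P) (hμ : HasMarkovWeight r P μ)
    (v : TdVertex d) (y : TdVertex d → M) :
    μ (cylEvent ↑(ballTd r v) y) = P v (cylEvent ↑(ballTd r v) y) := by
  induction hn : v.1.length generalizing v y with
  | zero =>
    obtain rfl : v = rootTd d := Subtype.ext (List.length_eq_zero_iff.1 hn)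
    have := hμ _ (rootClosed_singleton d) y
    rw [regionTd_singleton] at this
    simpa [markovWeight, vertexWeight] using this
  | succ n ih =>
    have hv0 : v ≠ rootTd d := by
      rintro rfl
      simp [rootTd] at hn
    have hadj := adj_parentTd hv0
    have hpn : (parentTd v).1.length = n := by simp [parentTd, hn]
    rw [hμ.measure_cylEvent_ballTd_eq_mul (rootClosed_SrSet d n)
      (fun h => by have := mem_toFinset_SrSet.1 h; omega) (mem_toFinset_SrSet.2 hpn.le),
      ← fiberSum_cylEvent μ (edgeBallTd_subset_left hadj),
      show (fun y => μ (cylEvent ↑(ballTd r (parentTd v)) y)) = _ from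
        funext fun y => ih (parentTd v) y hpn,
      fiberSum_cylEvent (P (parentTd v)) (edgeBallTd_subset_left hadj), hP _ _ hadj,
      vertexWeight, if_neg hv0]
    by_cases h0 : P v (cylEvent ↑(edgeBallTd r (parentTd v) v) y) = 0
    · rw [h0, mul_zero]
      exact (measure_mono_null (cylEvent_anti (edgeBallTd_subset_right hadj) y) h0).symm
    · exact ENNReal.div_mul_cancel h0 (measure_ne_top _ _)

lemma measure_cylEvent_eq_fiberSum_mul {μ : Measure (TdVertex d → M)}
    {G₁ G₂ E : Finset (TdVertex d)} (h₁₂ : Disjoint G₁ G₂) (h₁ : Disjoint G₁ E)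
    (h₂ : Disjoint G₂ E) {f g : (TdVertex d → M) → ℝ≥0∞}
    (hf : DependsOn f (↑G₁ ∪ ↑E)) (hg : DependsOn g (↑G₂ ∪ ↑E))
    (hμ : ∀ y, μ (cylEvent ↑(G₁ ∪ G₂ ∪ E) y) = f y * g y)
    {F₁ F₂ : Finset (TdVertex d)} (hF₁ : F₁ ⊆ G₁) (hF₂ : F₂ ⊆ G₂) (y : TdVertex d → M) :
    μ (cylEvent ↑(F₁ ∪ F₂ ∪ E) y) = fiberSum (G₁ \ F₁) f y * fiberSum (G₂ \ F₂) g y := by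
  have hdiff : (G₁ ∪ G₂ ∪ E) \ (F₁ ∪ F₂ ∪ E) = (G₁ \ F₁) ∪ (G₂ \ F₂) := by
    rw [Finset.disjoint_left] at h₁₂ h₁ h₂
    ext x
    have a1 := @h₁₂ x
    have a2 := @h₁ x
    have a3 := @h₂ x
    have a4 := @hF₁ x
    have a5 := @hF₂ x
    simp only [Finset.mem_sdiff, Finset.mem_union]
    tauto
  rw [← fiberSum_cylEvent μ (Finset.union_subset_union_left (Finset.union_subset_union hF₁ hF₂)),
    hdiff, funext hμ]
  refine fiberSum_union_mul (h₁₂.mono Finset.sdiff_subset Finset.sdiff_subset)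
    (S := ↑G₁ ∪ ↑E) (T := ↑G₂ ∪ ↑E) ?_ ?_ hf hg y
  · rw [← Finset.coe_union, Finset.disjoint_coe]
    exact (Finset.disjoint_union_left.2 ⟨h₁₂, h₂.symm⟩).mono_right Finset.sdiff_subset
  · rw [← Finset.coe_union, Finset.disjoint_coe]
    exact (Finset.disjoint_union_left.2 ⟨h₁₂.symm, h₁.symm⟩).mono_right Finset.sdiff_subset

lemma HasMarkovWeight.rMarkov {μ : Measure (TdVertex d → M)} (hμ : HasMarkovWeight r P μ) :
    rMarkov r μ := by
  intro u w _ _ hadj F₁ F₂ hF₁ hF₂ y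
  rw [Set.inter_univ] at hF₁ hF₂ ⊢
  obtain ⟨n, hn⟩ := exists_subset_SrSet (F₁ ∪ F₂ ∪ {u})
  set A := (finite_SrSet d n).toFinset with hA
  set E := edgeBallTd r u w with hE
  have hEA : E ⊆ regionTd r A := (edgeBallTd_subset_left hadj).trans
    (ballTd_subset_regionTd (hn (by simp)))
  have hside : ∀ x, x ∈ sideOf w u ↔ x ∉ sideOf u w := fun x =>
    ⟨fun h h' => Set.disjoint_left.1 (disjoint_sideOf _ _) h h', fun h =>
      ((mem_sideOf_or hadj x).resolve_left fun h' => h h'.1).1⟩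
  set G₁ := {x ∈ regionTd r A | x ∈ sideOf u w} \ E with hG₁
  set G₂ := {x ∈ regionTd r A | x ∉ sideOf u w} \ E with hG₂
  have hunion : G₁ ∪ G₂ ∪ E = regionTd r A := by
    rw [hG₁, hG₂, ← Finset.union_sdiff_distrib, Finset.filter_union_filter_not_eq,
      Finset.sdiff_union_of_subset hEA]
  have hf : DependsOn (markovWeight r P {v ∈ A | v ∈ sideOf u w}) (↑G₁ ∪ ↑E) := by
    refine dependsOn_prod_vertexWeight fun v hv x hx => ?_
    obtain ⟨hvA, hvs⟩ := Finset.mem_filter.1 hv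
    by_cases hxE : x ∈ E
    · exact Or.inr hxE
    · exact Or.inl (Finset.mem_sdiff.2 ⟨Finset.mem_filter.2 ⟨ballTd_subset_regionTd hvA hx,
        (mem_sideOf_or_mem_edgeBallTd hadj hvs hx).resolve_right hxE⟩, hxE⟩)
  have hg : DependsOn (markovWeight r P {v ∈ A | v ∉ sideOf u w}) (↑G₂ ∪ ↑E) := by
    refine dependsOn_prod_vertexWeight fun v hv x hx => ?_
    obtain ⟨hvA, hvs⟩ := Finset.mem_filter.1 hv
    by_cases hxE : x ∈ E
    · exact Or.inr hxE
    · rw [hE, edgeBallTd_comm] at hxE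
      exact Or.inl (Finset.mem_sdiff.2 ⟨Finset.mem_filter.2 ⟨ballTd_subset_regionTd hvA hx,
        (hside x).1 ((mem_sideOf_or_mem_edgeBallTd hadj.symm ((hside v).2 hvs) hx).resolve_right
          hxE)⟩, by rwa [hE, edgeBallTd_comm]⟩)
  have hfac : ∀ y, μ (cylEvent ↑(G₁ ∪ G₂ ∪ E) y) =
      markovWeight r P {v ∈ A | v ∈ sideOf u w} y *
        markovWeight r P {v ∈ A | v ∉ sideOf u w} y := fun y => by
    rw [hunion, hμ _ (rootClosed_SrSet d n), ← hA, markovWeight, markovWeight, markovWeight,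
      Finset.prod_filter_mul_prod_filter_not]
  have key := fun {F F' : Finset (TdVertex d)} (hF : F ⊆ G₁) (hF' : F' ⊆ G₂) =>
    measure_cylEvent_eq_fiberSum_mul
      ((Finset.disjoint_filter_filter_not _ _ _).mono Finset.sdiff_subset Finset.sdiff_subset)
      Finset.sdiff_disjoint Finset.sdiff_disjoint hf hg hfac hF hF' y
  have hF₁' : F₁ \ E ⊆ G₁ := fun x hx => by
    obtain ⟨hx, hxE⟩ := Finset.mem_sdiff.1 hx
    exact Finset.mem_sdiff.2 ⟨Finset.mem_filter.2
      ⟨subset_regionTd r A (hn (by simp [hx])), hF₁ hx⟩, hxE⟩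
  have hF₂' : F₂ \ E ⊆ G₂ := fun x hx => by
    obtain ⟨hx, hxE⟩ := Finset.mem_sdiff.1 hx
    exact Finset.mem_sdiff.2 ⟨Finset.mem_filter.2
      ⟨subset_regionTd r A (hn (by simp [hx])), (hside x).1 (hF₂ hx)⟩, hxE⟩
  have e₁₂ := key hF₁' hF₂'
  have e₁ := key hF₁' (Finset.empty_subset G₂)
  have e₂ := key (Finset.empty_subset G₁) hF₂'
  have e₀ := key (Finset.empty_subset G₁) (Finset.empty_subset G₂)
  rw [← Finset.union_sdiff_distrib, Finset.sdiff_union_self_eq_union] at e₁₂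
  rw [Finset.union_empty, Finset.sdiff_union_self_eq_union] at e₁
  rw [Finset.empty_union, Finset.sdiff_union_self_eq_union] at e₂
  rw [Finset.empty_union, Finset.empty_union] at e₀
  rw [← coe_edgeBallTd, ← Finset.coe_union, ← Finset.coe_union, ← Finset.coe_union,
    ← Finset.coe_union, ← hE, e₁₂, e₁, e₂, e₀]
  ring

lemma hasMarkovWeight_of_rMarkov [∀ v, IsProbabilityMeasure (P v)]
    {μ : Measure (TdVertex d → M)} [IsFiniteMeasure μ] (hμ : rMarkov r μ)
    (hμP : ∀ v y, μ (cylEvent ↑(ballTd r v) y) = P v (cylEvent ↑(ballTd r v) y)) :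
    HasMarkovWeight r P μ := by
  intro A hA
  refine RootClosed.induction_from
    (P := fun A => ∀ y, μ (cylEvent ↑(regionTd r A) y) = markovWeight r P A y) ?_
    (fun A w _ hA hw hpar ih y => ?_) A hA (Finset.singleton_subset_iff.2 hA.1)
    (rootClosed_singleton d)
  · intro y
    rw [regionTd_singleton, hμP]
    simp [markovWeight, vertexWeight]
  have hw0 : w ≠ rootTd d := fun h => hw (h ▸ hA.1)
  have hadj := adj_parentTd hw0
  set E := edgeBallTd r (parentTd w) w with hE
  have hEA : E ⊆ regionTd r A :=
    (edgeBallTd_subset_left hadj).trans (ballTd_subset_regionTd hpar)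
  have hEw : E ⊆ ballTd r w := edgeBallTd_subset_right hadj
  have hM := hμ (parentTd w) w trivial trivial hadj {x ∈ regionTd r A | x ∈ sideOf (parentTd w) w}
    {x ∈ ballTd r w | x ∈ sideOf w (parentTd w)}
    (fun x hx => ⟨(Finset.mem_filter.1 hx).2, trivial⟩)
    (fun x hx => ⟨(Finset.mem_filter.1 hx).2, trivial⟩) y
  have h1 : {x ∈ regionTd r A | x ∈ sideOf (parentTd w) w} ∪ E = regionTd r A := by
    refine (Finset.union_subset (Finset.filter_subset _ _) hEA).antisymm fun x hx => ?_
    obtain ⟨v, hv, hxv⟩ := Finset.mem_biUnion.1 hx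
    rw [Finset.mem_union, Finset.mem_filter]
    exact (mem_sideOf_or_mem_edgeBallTd hadj (hA.subset_sideOf hw hv) hxv).imp_left
      fun h => ⟨hx, h⟩
  have h2 : {x ∈ ballTd r w | x ∈ sideOf w (parentTd w)} ∪ E = ballTd r w := by
    refine (Finset.union_subset (Finset.filter_subset _ _) hEw).antisymm fun x hx => ?_
    rw [Finset.mem_union, Finset.mem_filter, hE, edgeBallTd_comm]
    exact (mem_sideOf_or_mem_edgeBallTd hadj.symm (left_mem_sideOf hadj.symm) hx).imp_left
      fun h => ⟨hx, h⟩
  rw [Set.inter_univ, ← coe_edgeBallTd, ← Finset.coe_union, ← Finset.coe_union,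
    ← Finset.coe_union, ← Finset.coe_union, Finset.union_union_distrib_right, h1, h2] at hM
  rw [hμP] at hM
  have hμE : μ (cylEvent ↑E y) = P w (cylEvent ↑E y) := by
    rw [← fiberSum_cylEvent μ hEw, ← fiberSum_cylEvent (P w) hEw, funext (hμP w)]
  rw [regionTd_insert, Finset.union_comm, markovWeight_insert hw, ← ih y, vertexWeight,
    if_neg hw0, ← mul_div_assoc, ← hM, ← hE, ← hμE]
  by_cases h0 : μ (cylEvent ↑E y) = 0
  · rw [h0, mul_zero, ENNReal.zero_div]
    exact measure_mono_null (cylEvent_anti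
      (Finset.coe_subset.2 (hEA.trans Finset.subset_union_left)) y) h0
  · exact (ENNReal.mul_div_cancel_right h0 (measure_ne_top _ _)).symm

end MarkovWeight

/-! ### Automorphisms of `T_d` and cylinder events -/

section Automorphisms

variable {d r : ℕ} {M : Type}

lemma image_ballTd (φ : TdGraph d ≃g TdGraph d) (v : TdVertex d) :
    φ '' ↑(ballTd r v) = ↑(ballTd r (φ v)) := by
  ext x
  obtain ⟨x, rfl⟩ := φ.surjective x
  rw [φ.injective.mem_set_image, Finset.mem_coe, Finset.mem_coe, mem_ballTd, mem_ballTd,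
    treeDist_map φ]

lemma image_edgeBall (φ : TdGraph d ≃g TdGraph d) (u w : TdVertex d) :
    φ '' edgeBall r u w = edgeBall r (φ u) (φ w) := by
  ext x
  obtain ⟨x, rfl⟩ := φ.surjective x
  rw [φ.injective.mem_set_image]
  change (_ ∨ _) ↔ (_ ∨ _)
  rw [treeDist_map φ, treeDist_map φ]

lemma image_sideOf (φ : TdGraph d ≃g TdGraph d) (u w : TdVertex d) :
    φ '' sideOf u w = sideOf (φ u) (φ w) := by
  ext x
  obtain ⟨x, rfl⟩ := φ.surjective x
  rw [φ.injective.mem_set_image]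
  change (_ : ℕ) < _ ↔ (_ : ℕ) < _
  rw [treeDist_map φ, treeDist_map φ]

lemma coe_ballTd_rootTd : (↑(ballTd r (rootTd d)) : Set (TdVertex d)) = SrSet d r := by
  ext x
  rw [Finset.mem_coe, mem_ballTd, show (rootTd d).1 = [] from rfl, treeDist_nil]
  rfl

lemma edgeBall_rootTd_node1 (hd : 1 ≤ d) : edgeBall r (rootTd d) (node1 d) = ErSet d r := by
  ext x
  change (_ ∨ _) ↔ (_ ∨ _)
  rw [node1_val hd, show (rootTd d).1 = [] from rfl, treeDist_nil]
  by_cases h : [1] <:+ x.1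
  · have h1 := treeDist_cons_of_suffix h
    rw [treeDist_nil] at h1
    have h2 : x.1.getLast? = some 1 := by
      obtain ⟨s, hs⟩ := h
      rw [← hs, List.getLast?_append]
      rfl
    rw [h1]
    simp [h2]
  · have h1 := treeDist_cons_of_not_suffix h
    rw [treeDist_nil] at h1
    have h2 : x.1.getLast? ≠ some 1 := fun h2 => h <| by
      rw [List.getLast?_eq_some_iff] at h2
      obtain ⟨s, hs⟩ := h2
      exact ⟨s, hs.symm⟩
    rw [h1]
    simp only [h2, false_and, or_false]
    omega

variable [MeasurableSpace M]

lemma measurable_relabel (φ : TdGraph d ≃g TdGraph d) :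
    Measurable (fun (x : TdVertex d → M) v => x (φ v)) :=
  measurable_pi_lambda _ fun v => measurable_pi_apply (φ v)

lemma measurable_restrict_vertices (S : Set (TdVertex d)) :
    Measurable (fun (x : TdVertex d → M) (v : S) => x v.1) :=
  measurable_pi_lambda _ fun v => measurable_pi_apply v.1

lemma restrictErOfSr_restrictTo (μ : Measure (TdVertex d → M)) :
    restrictErOfSr d r (restrictTo (SrSet d r) μ) = restrictTo (ErSet d r) μ :=
  Measure.map_map (measurable_pi_lambda _ fun _ => measurable_pi_apply _)
    (measurable_restrict_vertices _)

lemma exists_restrictTo_eq [Nonempty M] {S : Set (TdVertex d)} (p : Measure (S → M))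
    [IsProbabilityMeasure p] :
    ∃ ν : Measure (TdVertex d → M), IsProbabilityMeasure ν ∧ restrictTo S ν = p := by
  have hmeas : Measurable fun (x : S → M) (v : TdVertex d) =>
      if h : v ∈ S then x ⟨v, h⟩ else Classical.arbitrary M :=
    measurable_pi_lambda _ fun v => by
      by_cases h : v ∈ S
      · simpa only [h, dif_pos] using measurable_pi_apply (⟨v, h⟩ : S)
      · simp only [h, dif_neg, not_false_eq_true, measurable_const]
  refine ⟨p.map _, Measure.isProbabilityMeasure_map hmeas.aemeasurable, ?_⟩
  rw [restrictTo, Measure.map_map (measurable_restrict_vertices S) hmeas]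
  convert Measure.map_id
  ext x v
  simp

variable [DiscreteMeasurableSpace M]

lemma map_relabel_cylEvent (μ : Measure (TdVertex d → M)) (φ : TdGraph d ≃g TdGraph d)
    (C : Set (TdVertex d)) (y : TdVertex d → M) :
    μ.map (fun x v => x (φ v)) (cylEvent C y) = μ (cylEvent (φ '' C) (y ∘ φ.symm)) := by
  rw [Measure.map_apply (measurable_relabel φ) (measurableSet_cylEvent C y)]
  congr 1
  ext x
  simp [cylEvent]

lemma rMarkov.map_relabel {μ : Measure (TdVertex d → M)} (hμ : rMarkov r μ)
    (φ : TdGraph d ≃g TdGraph d) : rMarkov r (μ.map (fun x v => x (φ v))) := by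
  intro u w _ _ hadj F₁ F₂ hF₁ hF₂ y
  have h := hμ (φ u) (φ w) trivial trivial (φ.map_adj_iff.2 hadj) (F₁.image φ) (F₂.image φ)
    (by rw [Set.inter_univ, ← image_sideOf, Finset.coe_image]
        exact Set.image_mono fun x hx => (hF₁ hx).1)
    (by rw [Set.inter_univ, ← image_sideOf, Finset.coe_image]
        exact Set.image_mono fun x hx => (hF₂ hx).1) (y ∘ φ.symm)
  simp only [Set.inter_univ, map_relabel_cylEvent, Set.image_union, image_edgeBall,
    Finset.coe_image] at h ⊢
  exact h

lemma restrictTo_apply (μ : Measure (TdVertex d → M)) {S C : Set (TdVertex d)} (hC : C ⊆ S)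
    (y : TdVertex d → M) :
    restrictTo S μ {x | ∀ v ∈ (Subtype.val ⁻¹' C : Set S), x v = y v.1} = μ (cylEvent C y) := by
  rw [restrictTo, Measure.map_apply (measurable_restrict_vertices S)
    (measurableSet_forall_eq _ fun v : S => y v.1)]
  congr 1
  ext x
  simp only [cylEvent, Set.mem_preimage, Set.mem_ofPred_eq, Subtype.forall]
  exact ⟨fun h v hv => h v (hC hv) hv, fun h v _ hv => h v hv⟩

lemma restrictTo_eq_of_cylEvent [Finite M] [Nonempty M] {μ ν : Measure (TdVertex d → M)}
    {S : Set (TdVertex d)} (hS : S.Finite) (h : ∀ y, μ (cylEvent S y) = ν (cylEvent S y)) :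
    restrictTo S μ = restrictTo S ν := by
  have := hS.to_subtype
  refine Measure.ext_of_singleton fun z => ?_
  obtain ⟨y, rfl⟩ : ∃ y : TdVertex d → M, z = fun v => y v.1 :=
    ⟨fun v => if hv : v ∈ S then z ⟨v, hv⟩ else Classical.arbitrary M, by ext v; simp⟩
  have hz : ({fun v => y v.1} : Set (S → M)) =
      {x | ∀ v ∈ (Subtype.val ⁻¹' S : Set S), x v = y v.1} := by
    ext x
    simp [funext_iff]
  rw [hz, restrictTo_apply μ subset_rfl, restrictTo_apply ν subset_rfl, h]

/-- The restriction of an automorphism of `T_d` to an isomorphism of an invariant induced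
subgraph. -/
def restrictIso (φ : TdGraph d ≃g TdGraph d) (S : Set (TdVertex d)) (h : φ '' S = S) :
    (TdGraph d).induce S ≃g (TdGraph d).induce S where
  toEquiv := φ.toEquiv.subtypeEquiv fun v => by
    conv_rhs => rw [← h]
    exact (φ.injective.mem_set_image).symm
  map_rel_iff' := φ.map_rel_iff

lemma measure_cylEvent_image {μ : Measure (TdVertex d → M)} {S C : Set (TdVertex d)}
    {φ : TdGraph d ≃g TdGraph d} (h : φ '' S = S)
    (hμ : (restrictTo S μ).map (fun x v => x (restrictIso φ S h v)) = restrictTo S μ)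
    (hC : C ⊆ S) (y : TdVertex d → M) :
    μ (cylEvent (φ '' C) y) = μ (cylEvent C (y ∘ φ)) := by
  rw [← restrictTo_apply μ hC, ← hμ, Measure.map_apply
    (measurable_pi_lambda _ fun _ => measurable_pi_apply _)
    (measurableSet_forall_eq _ fun v : S => (y ∘ φ) v.1),
    ← restrictTo_apply μ (h ▸ Set.image_mono hC : φ '' C ⊆ S)]
  congr 1
  ext x
  simp only [Set.mem_preimage, Set.mem_ofPred_eq]
  constructor
  · exact fun hx v hv => hx (restrictIso φ S h v) ⟨v.1, hv, rfl⟩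
  · intro hx v hv
    obtain ⟨u, hu, huv⟩ := hv
    have := hx ⟨u, hC hu⟩ hu
    rw [show restrictIso φ S h ⟨u, hC hu⟩ = v from Subtype.ext huv] at this
    rw [this, ← huv]
    rfl

lemma measure_cylEvent_image_of_map_root {μ : Measure (TdVertex d → M)}
    (hμ : restrictTo (SrSet d r) μ ∈ IdrMeas d r M) {φ : TdGraph d ≃g TdGraph d}
    (hφ : φ (rootTd d) = rootTd d) {C : Set (TdVertex d)} (hC : C ⊆ SrSet d r)
    (y : TdVertex d → M) : μ (cylEvent (φ '' C) y) = μ (cylEvent C (y ∘ φ)) :=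
  have h : φ '' SrSet d r = SrSet d r := by rw [← coe_ballTd_rootTd, image_ballTd, hφ]
  measure_cylEvent_image h (hμ.2.1 (restrictIso φ _ h)) hC y

lemma measure_cylEvent_ErSet_comp {μ : Measure (TdVertex d → M)} (hd : 1 ≤ d)
    (hμ : restrictTo (SrSet d r) μ ∈ IdrMeas d r M) {φ : TdGraph d ≃g TdGraph d}
    (h₀ : φ (rootTd d) = node1 d) (h₁ : φ (node1 d) = rootTd d) (y : TdVertex d → M) :
    μ (cylEvent (ErSet d r) (y ∘ φ)) = μ (cylEvent (ErSet d r) y) := by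
  have h : φ '' ErSet d r = ErSet d r := by
    rw [← edgeBall_rootTd_node1 hd, image_edgeBall, h₀, h₁]
    exact Set.ext fun _ => or_comm
  have hE := hμ.2.2 (restrictIso φ _ h) fun _ => h₀
  rw [restrictErOfSr_restrictTo] at hE
  rw [← measure_cylEvent_image h hE subset_rfl, h]

/-! ### Marginals around all vertices from the marginal around the root -/

lemma exists_edgeCompatible (hd : 3 ≤ d) {ν : Measure (TdVertex d → M)} [IsProbabilityMeasure ν]
    (hν : restrictTo (SrSet d r) ν ∈ IdrMeas d r M) :
    ∃ P : TdVertex d → Measure (TdVertex d → M), (∀ v, IsProbabilityMeasure (P v)) ∧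
      EdgeCompatible r P ∧ ∀ v (φ : TdGraph d ≃g TdGraph d), φ v = rootTd d → ∀ y,
        P v (cylEvent ↑(ballTd r v) y) = ν (cylEvent (SrSet d r) (y ∘ φ.symm)) := by
  choose α hα using exists_iso_map_eq_root hd
  have key : ∀ v (φ : TdGraph d ≃g TdGraph d), φ v = rootTd d → ∀ C ⊆ ballTd r v, ∀ y,
      ν.map (fun x u => x (α v u)) (cylEvent ↑C y) =
        ν (cylEvent (φ '' ↑C) (y ∘ φ.symm)) := by
    intro v φ hφ C hC y
    have hsub : α v '' ↑C ⊆ SrSet d r := by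
      rw [← coe_ballTd_rootTd, ← hα v, ← image_ballTd]
      exact Set.image_mono (Finset.coe_subset.2 hC)
    have h := measure_cylEvent_image_of_map_root hν (φ := (α v).symm.trans φ)
      (by rw [RelIso.trans_apply, (α v).symm_apply_eq.2 (hα v).symm, hφ]) hsub (y ∘ φ.symm)
    rw [map_relabel_cylEvent]
    convert h.symm using 3
    · ext u
      simp
    · rw [← Set.image_comp]
      congr 1
      ext u
      simp
  refine ⟨fun v => ν.map fun x u => x (α v u),
    fun v => Measure.isProbabilityMeasure_map (measurable_relabel _).aemeasurable,
    fun u w hadj y => ?_, fun v φ hφ y => ?_⟩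
  · obtain ⟨φ, hu, hw⟩ := exists_iso_map_arc hd hadj
    obtain ⟨τ, h₀, h₁⟩ := exists_iso_flipEdge hd
    have hn := node1_val (d := d) (by omega)
    replace h₀ : τ (rootTd d) = node1 d := Subtype.ext (h₀.trans hn.symm)
    replace h₁ : τ (node1 d) = rootTd d := Subtype.ext (h₁ _ hn)
    have hE : φ '' edgeBall r u w = ErSet d r := by
      rw [image_edgeBall, hu, hw, edgeBall_rootTd_node1 (by omega)]
    have hE' : (φ.trans τ) '' edgeBall r u w = ErSet d r := by
      rw [image_edgeBall, ← edgeBall_rootTd_node1 (by omega)]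
      simp only [RelIso.trans_apply, hu, hw, h₀, h₁]
      exact Set.ext fun _ => or_comm
    rw [key u φ hu _ (edgeBallTd_subset_left hadj),
      key w (φ.trans τ) (by simp [hw, h₁]) _ (edgeBallTd_subset_right hadj), coe_edgeBallTd,
      hE, hE']
    refine Eq.trans ?_ (measure_cylEvent_ErSet_comp (by omega) hν h₀ h₁ _)
    congr 2
    ext x
    simp
  · rw [key v φ hφ _ subset_rfl, image_ballTd, hφ, coe_ballTd_rootTd]

end Automorphisms

/-- For every `p ∈ I_{d,r}(M)` there exists a unique `r`-Markov invariant
process `μ(p) ∈ I_d(M)` whose marginal on the ball `S_r` is equal to `p`. -/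
theorem exists_unique_markov_extension
    (d : ℕ) (hd : 3 ≤ d) (M : Type) [Fintype M] [MeasurableSpace M]
    [DiscreteMeasurableSpace M]
    (r : ℕ) (hr : 1 ≤ r) (p : Measure (↥(SrSet d r) → M)) (hp : p ∈ IdrMeas d r M) :
    ∃! μ : Measure (TdVertex d → M),
      μ ∈ InvMeas d M ∧ rMarkov r μ ∧ restrictTo (SrSet d r) μ = p := by
  have := hp.1
  have hM : Nonempty M := by
    obtain ⟨x⟩ := p.nonempty_of_neZero
    exact ⟨x ⟨rootTd d, Nat.zero_le r⟩⟩
  obtain ⟨ν, hν, rfl⟩ := exists_restrictTo_eq p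
  obtain ⟨P, hP, hcompat, hball⟩ := exists_edgeCompatible hd hp
  obtain ⟨μ, hμ, hμW⟩ := exists_hasMarkovWeight hcompat
  have hμP := hμW.measure_cylEvent_ballTd hcompat
  have huniq : ∀ μ' : Measure (TdVertex d → M), IsProbabilityMeasure μ' → rMarkov r μ' →
      (∀ v y, μ' (cylEvent ↑(ballTd r v) y) = P v (cylEvent ↑(ballTd r v) y)) → μ' = μ :=
    fun μ' _ h1 h2 => (hasMarkovWeight_of_rMarkov h1 h2).measure_eq hμW
  refine ⟨μ, ⟨⟨hμ, fun φ => ?_⟩, hμW.rMarkov, ?_⟩, ?_⟩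
  · refine huniq _ (Measure.isProbabilityMeasure_map (measurable_relabel φ).aemeasurable)
      (hμW.rMarkov.map_relabel φ) fun v y => ?_
    obtain ⟨α, hα⟩ := exists_iso_map_eq_root hd (φ v)
    rw [map_relabel_cylEvent, image_ballTd, hμP, hball _ α hα, hball v (φ.trans α) hα]
    rfl
  · refine restrictTo_eq_of_cylEvent (finite_SrSet d r) fun y => ?_
    have h := hball (rootTd d) (RelIso.refl _) rfl y
    rw [← hμP, coe_ballTd_rootTd] at h
    exact h
  · rintro μ' ⟨⟨hμ', hinv⟩, hmarkov, hres⟩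
    refine huniq μ' hμ' hmarkov fun v y => ?_
    obtain ⟨α, hα⟩ := exists_iso_map_eq_root hd v
    rw [hball v α hα, ← restrictTo_apply ν subset_rfl, ← hres, restrictTo_apply μ' subset_rfl]
    conv_lhs => rw [← hinv α]
    rw [map_relabel_cylEvent, image_ballTd, hα, coe_ballTd_rootTd]

end TreeEntropy
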